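/- arXiv:1611.04903 — 5 statements merged into one kernel-verified Lean document; each statement's English description precedes it below -/
import Mathlib

section
/- Let A, B be integers with −1 ≤ A ≤ B, B ≥ 2 and 2A < B + 3, let M be the 2×2 real matrix with rows (0, −B) and (1, −A), and let T^ℓ be the unique nonempty compact subset of ℝ² satisfying M·T^ℓ = ⋃_{i=0}^{B−1} (T^ℓ + (i,0)). Then for every nonzero z ∈ ℤ², one has T^ℓ ∩ (T^ℓ + z) ≠ ∅ if and only if: (i) when A > 0, z ∈ {(A,1), (A−1,1), (1,0), (−1,0), (−A,−1), (−A+1,−1)}; (ii) when A = 0, z ∈ {(1,0), (−1,0), (1,1), (−1,1), (1,−1), (−1,−1), (0,1), (0,−1)}; (iii) when A = −1, z ∈ {(−1,1), (0,1), (1,0), (−1,0), (1,−1), (0,−1)}. In particular, T^ℓ has exactly six neighbors when A ≠ 0 and exactly eight when A = 0. -/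
open Set Pointwise

noncomputable section

/-- The plane. -/
abbrev Pt : Type := Fin 2 → ℝ

/-- A planar set is disk-like if it is homeomorphic to the closed unit (Euclidean) disk. -/
def DiskLike (S : Set Pt) : Prop :=
  Nonempty (↥S ≃ₜ ↥(Metric.closedBall (0 : EuclideanSpace ℝ (Fin 2)) 1))

/-- The set equation `M T + ((B-1)/2, 0) = (⋃_{i=0}^{B-2} (T + (i,0))) ∪ (-T)`
for `M = !![0, -B; 1, -A]`. -/
def CrysEq (A B : ℤ) (T : Set Pt) : Prop :=
  (fun x => (!![0, -(B:ℝ); 1, -(A:ℝ)]).mulVec x + ![((B:ℝ)-1)/2, 0]) '' T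
    = (⋃ i ∈ Finset.Icc (0:ℤ) (B-2), (fun x => x + ![(i:ℝ), 0]) '' T) ∪ (-T)

/-- The set equation `M L = ⋃_{i=0}^{B-1} (L + (i,0))` for `M = !![0, -B; 1, -A]`. -/
def LatEq (A B : ℤ) (L : Set Pt) : Prop :=
  (fun x => (!![0, -(B:ℝ); 1, -(A:ℝ)]).mulVec x) '' L
    = ⋃ i ∈ Finset.Icc (0:ℤ) (B-1), (fun x => x + ![(i:ℝ), 0]) '' L

/-- Membership in the crystallographic group p2: maps `x ↦ ε x + (p,q)`,
`ε = ±1`, `p q` integers. -/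
def IsP2 (γ : Pt → Pt) : Prop :=
  ∃ (ε : ℝ) (p q : ℤ), (ε = 1 ∨ ε = -1) ∧ γ = fun x => ε • x + ![(p:ℝ), (q:ℝ)]

/-- Three steps of the recursion started at an element `m` of maximal modulus force `m ≤ 1`. -/
theorem le_one_of_recursion {a B m r₁ r₂ r₃ r₄ : ℤ} (ha : 0 ≤ a) (hB : 2 ≤ B)
    (h2a : 2 * a < B + 3) (h₁ : r₁ ≤ m) (h₂ : -m ≤ r₂) (h₃ : -m ≤ r₃) (h₄ : -m ≤ r₄)
    (e₂ : r₂ ≤ a * r₁ + (B - 1) - B * m) (e₃ : r₃ ≤ a * r₂ + (B - 1) - B * r₁)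
    (e₄ : r₄ ≤ a * r₃ + (B - 1) - B * r₂) : m ≤ 1 := by
  by_contra! hm
  obtain rfl | rfl | ha2 : a = 0 ∨ a = 1 ∨ 2 ≤ a := by omega
  · nlinarith
  · obtain rfl | hB3 : B = 2 ∨ 3 ≤ B := by omega
    · omega
    · have hB3' : B ≤ 3 := by nlinarith
      obtain rfl : B = 3 := by omega
      omega
  have hr₁ : 0 ≤ r₁ := by
    by_contra! h
    nlinarith
  have key : a * B * m ≤ (a + 1) * (B - 1) + m + (a ^ 2 - B) * r₁ := by nlinarith
  obtain hlt | hge := lt_or_ge (a ^ 2) B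
  · have : 0 ≤ (B - a ^ 2) * r₁ := by nlinarith
    have : (a * B - 1) * 2 ≤ (a * B - 1) * m := by
      apply mul_le_mul_of_nonneg_left (by omega)
      nlinarith
    nlinarith
  · have h5 : (a ^ 2 - B) * r₁ ≤ (a ^ 2 - B) * m :=
      mul_le_mul_of_nonneg_left h₁ (by omega)
    have h6 : 0 < a * B - 1 - a ^ 2 + B := by nlinarith
    have h7 : (a * B - 1 - a ^ 2 + B) * 2 ≤ (a * B - 1 - a ^ 2 + B) * m :=
      mul_le_mul_of_nonneg_left (by omega) h6.le
    have h8 : (a + 1) * (B - 1) ≤ 2 * a ^ 2 - 2 * a := by nlinarith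
    have ha3 : a ≤ 3 := by nlinarith
    obtain rfl | rfl : a = 2 ∨ a = 3 := by omega
    · obtain rfl : B = 2 := by omega
      omega
    · obtain rfl : B = 4 := by omega
      omega

theorem LatEq.exists_expand {A B : ℤ} {L : Set Pt} (hL : LatEq A B L) {x : Pt} (hx : x ∈ L) :
    ∃ i : ℤ, 0 ≤ i ∧ i ≤ B - 1 ∧ ∃ y ∈ L, -(B : ℝ) * x 1 = y 0 + i ∧ x 0 - A * x 1 = y 1 := by
  have h := hL.subset (mem_image_of_mem _ hx)
  simp only [mem_iUnion, Finset.mem_Icc, mem_image] at h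
  obtain ⟨i, ⟨h0, h1⟩, y, hy, e⟩ := h
  have e0 := congrFun e 0
  have e1 := congrFun e 1
  simp [Matrix.mulVec, dotProduct, Fin.sum_univ_two] at e0 e1
  exact ⟨i, h0, h1, y, hy, by linarith, by linarith⟩

theorem LatEq.exists_contract {A B : ℤ} {L : Set Pt} (hL : LatEq A B L) {y : Pt} (hy : y ∈ L)
    {i : ℤ} (h0 : 0 ≤ i) (h1 : i ≤ B - 1) :
    ∃ x ∈ L, -(B : ℝ) * x 1 = y 0 + i ∧ x 0 - A * x 1 = y 1 := by
  have h := hL.superset (mem_biUnion (Finset.mem_coe.2 (Finset.mem_Icc.2 ⟨h0, h1⟩))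
    (mem_image_of_mem _ hy))
  obtain ⟨x, hx, e⟩ := h
  have e0 := congrFun e 0
  have e1 := congrFun e 1
  simp [Matrix.mulVec, dotProduct, Fin.sum_univ_two] at e0 e1
  exact ⟨x, hx, by linarith, by linarith⟩

/-- The difference set of `L`, in the coordinates `(u, v)` of the vector `(v + A u, u)`; in these
coordinates multiplication by `M` becomes a shift of a two-term recursion. -/
def diffSet (A : ℤ) (L : Set Pt) : Set (ℝ × ℝ) :=
  (fun w : Pt × Pt => (w.1 1 - w.2 1, w.1 0 - w.2 0 - A * (w.1 1 - w.2 1))) '' (L ×ˢ L)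

theorem isCompact_diffSet (A : ℤ) {L : Set Pt} (hL : IsCompact L) : IsCompact (diffSet A L) :=
  (hL.prod hL).image (by fun_prop)

theorem neg_mem_diffSet {A : ℤ} {L : Set Pt} {u v : ℝ} (h : (u, v) ∈ diffSet A L) :
    (-u, -v) ∈ diffSet A L := by
  obtain ⟨⟨x, y⟩, ⟨hx, hy⟩, e⟩ := h
  simp only [Prod.mk.injEq] at e
  refine ⟨⟨y, x⟩, ⟨hy, hx⟩, ?_⟩
  simp only [Prod.mk.injEq]
  constructor <;> linarith

theorem inter_translate_nonempty_iff {A : ℤ} {L : Set Pt} (p q : ℤ) :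
    (L ∩ (fun x => x + ![(p : ℝ), (q : ℝ)]) '' L).Nonempty ↔
      ((q : ℝ), ((p - A * q : ℤ) : ℝ)) ∈ diffSet A L := by
  constructor
  · rintro ⟨_, hx, y, hy, rfl⟩
    refine ⟨⟨_, y⟩, ⟨hx, hy⟩, ?_⟩
    simp
  · rintro ⟨⟨x, y⟩, ⟨hx, hy⟩, e⟩
    simp only [Prod.mk.injEq] at e
    push_cast at e
    obtain ⟨e1, e2⟩ := e
    rw [e1] at e2
    refine ⟨x, hx, y, hy, ?_⟩
    ext i
    fin_cases i
    · simp only [Fin.zero_eta, Pi.add_apply, Matrix.cons_val_zero]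
      linarith
    · simp only [Fin.mk_one, Pi.add_apply, Matrix.cons_val_one, Matrix.cons_val_zero]
      linarith

theorem diffSet_shift {A B : ℤ} {L : Set Pt} (hL : LatEq A B L) {u v : ℤ}
    (h : ((u : ℝ), (v : ℝ)) ∈ diffSet A L) :
    ∃ w : ℤ, ((v : ℝ), (w : ℝ)) ∈ diffSet A L ∧ |w + A * v + B * u| ≤ B - 1 := by
  obtain ⟨⟨x, y⟩, ⟨hx, hy⟩, e⟩ := h
  simp only [Prod.mk.injEq] at e
  obtain ⟨i, hi0, hi1, x', hx', ex, ex'⟩ := hL.exists_expand hx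
  obtain ⟨j, hj0, hj1, y', hy', ey, ey'⟩ := hL.exists_expand hy
  obtain ⟨e1, e2⟩ := e
  have e3 : x' 1 - y' 1 = v := by linarith
  refine ⟨-B * u - (i - j) - A * v, ⟨⟨x', y'⟩, ⟨hx', hy'⟩, ?_⟩, ?_⟩
  · simp only [Prod.mk.injEq]
    refine ⟨e3, ?_⟩
    rw [e3]
    push_cast
    rw [← e1]
    linarith
  · rw [abs_le]
    constructor <;> linarith

theorem diffSet_unshift {A B : ℤ} {L : Set Pt} (hB : 2 ≤ B) (hL : LatEq A B L) {e : ℤ}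
    (he : |e| ≤ B - 1) {u v w : ℝ} (h : (v, w) ∈ diffSet A L) (huvw : w + A * v + B * u = e) :
    (u, v) ∈ diffSet A L := by
  obtain ⟨⟨x, y⟩, ⟨hx, hy⟩, e'⟩ := h
  simp only [Prod.mk.injEq] at e'
  obtain ⟨e1, e2⟩ := e'
  obtain ⟨i, j, hi0, hi1, hj0, hj1, hij⟩ :
      ∃ i j : ℤ, 0 ≤ i ∧ i ≤ B - 1 ∧ 0 ≤ j ∧ j ≤ B - 1 ∧ i - j = -e := by
    rw [abs_le] at he
    exact ⟨max (-e) 0, max e 0, by omega, by omega, by omega, by omega, by omega⟩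
  obtain ⟨x', hx', ex, ex'⟩ := hL.exists_contract hx hi0 hi1
  obtain ⟨y', hy', ey, ey'⟩ := hL.exists_contract hy hj0 hj1
  have hij' : (i : ℝ) - j = -e := by exact_mod_cast hij
  have hB' : (B : ℝ) ≠ 0 := by
    norm_cast
    omega
  rw [e1] at e2
  have eu : x' 1 - y' 1 = u := by
    apply mul_left_cancel₀ hB'
    linarith
  refine ⟨⟨x', y'⟩, ⟨hx', hy'⟩, ?_⟩
  simp only [Prod.mk.injEq]
  exact ⟨eu, by linarith⟩

/-- A Lyapunov function for the recursion `B u + A v + w = 0`. -/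
def lyapunov (A B : ℤ) (u v : ℝ) : ℝ := (B + 1) * (u ^ 2 + v ^ 2) + 2 * A * (u * v)

theorem eq_zero_of_lyapunov_nonpos {A B : ℤ} (hA : -1 ≤ A) (hAB : A ≤ B) (hB : 2 ≤ B) {u v : ℝ}
    (h : lyapunov A B u v ≤ 0) : u = 0 ∧ v = 0 := by
  have hA' : (-1 : ℝ) ≤ A := by exact_mod_cast hA
  have hAB' : (A : ℝ) ≤ B := by exact_mod_cast hAB
  have hB' : (2 : ℝ) ≤ B := by exact_mod_cast hB
  unfold lyapunov at h
  have h1 : 0 ≤ (B + A : ℝ) * (u + v) ^ 2 := mul_nonneg (by linarith) (sq_nonneg _)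
  have h2 : 0 ≤ (B - A : ℝ) * (u - v) ^ 2 := mul_nonneg (by linarith) (sq_nonneg _)
  have h3 : u ^ 2 + v ^ 2 ≤ 0 := by nlinarith
  constructor <;> nlinarith [sq_nonneg u, sq_nonneg v]

theorem lyapunov_shift {A B : ℤ} {u v w : ℝ} (h : w + A * v + B * u = 0) :
    lyapunov A B v w = lyapunov A B u v + (B - 1) * (w - u) ^ 2 := by
  unfold lyapunov
  linear_combination 2 * (w - u) * h

theorem eq_zero_of_lyapunov_le {A B : ℤ} (hA : -1 ≤ A) (hAB : A ≤ B) (hB : 2 ≤ B) {u v w t : ℝ}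
    (h : w + A * v + B * u = 0) (h' : t + A * w + B * v = 0)
    (hle : lyapunov A B w t ≤ lyapunov A B u v) : u = 0 ∧ v = 0 := by
  have hB' : (2 : ℝ) ≤ B := by exact_mod_cast hB
  rw [lyapunov_shift h', lyapunov_shift h] at hle
  have hw : w = u := by nlinarith [sq_nonneg (w - u), sq_nonneg (t - v)]
  have ht : t = v := by nlinarith [sq_nonneg (w - u), sq_nonneg (t - v)]
  subst hw ht
  apply eq_zero_of_lyapunov_nonpos hA hAB hB
  unfold lyapunov
  exact le_of_eq (by linear_combination w * h + t * h')

/-- A finite set of integer states in which the recursion can be continued forever consists of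
differences of elements of `L`. -/
theorem mem_diffSet_of_forall_exists {A B : ℤ} (hA : -1 ≤ A) (hAB : A ≤ B) (hB : 2 ≤ B)
    {L : Set Pt} (hLne : L.Nonempty) (hLc : IsCompact L) (hL : LatEq A B L) {S : Finset (ℤ × ℤ)}
    (hS : ∀ s ∈ S, ∃ w : ℤ, (s.2, w) ∈ S ∧ |w + A * s.2 + B * s.1| ≤ B - 1)
    {s : ℤ × ℤ} (hs : s ∈ S) : ((s.1 : ℝ), (s.2 : ℝ)) ∈ diffSet A L := by
  have hmin : ∀ s : ℤ × ℤ, ∃ k ∈ diffSet A L, ∀ k' ∈ diffSet A L,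
      lyapunov A B (s.1 - k.1) (s.2 - k.2) ≤ lyapunov A B (s.1 - k'.1) (s.2 - k'.2) := by
    intro s
    refine (isCompact_diffSet A hLc).exists_isMinOn ((hLne.prod hLne).image _)
      (f := fun k : ℝ × ℝ => lyapunov A B (s.1 - k.1) (s.2 - k.2)) ?_
    unfold lyapunov
    fun_prop
  choose k hk hkmin using hmin
  obtain ⟨t, ht, htmax⟩ := S.exists_max_image
    (fun s => lyapunov A B (s.1 - (k s).1) (s.2 - (k s).2)) ⟨s, hs⟩
  obtain ⟨w, hw, hwe⟩ := hS t ht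
  obtain ⟨w', hw', hwe'⟩ := hS _ hw
  have hB' : (B : ℝ) ≠ 0 := by
    norm_cast
    omega
  let c := k (w, w')
  set v₁ : ℝ := ((w' + A * w + B * t.2 : ℤ) - c.2 - A * c.1) / B with hv₁
  set u₁ : ℝ := ((w + A * t.2 + B * t.1 : ℤ) - c.1 - A * v₁) / B with hu₁
  rw [eq_div_iff hB'] at hv₁ hu₁
  have hc₁ : (v₁, c.1) ∈ diffSet A L :=
    diffSet_unshift hB hL hwe' (hk (w, w')) (by linarith)
  have hc₂ : (u₁, v₁) ∈ diffSet A L :=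
    diffSet_unshift hB hL hwe hc₁ (by linarith)
  push_cast at hv₁ hu₁
  have hle := (htmax _ hw').trans (hkmin t _ hc₂)
  obtain ⟨hu, hv⟩ := eq_zero_of_lyapunov_le hA hAB hB (by linear_combination -hu₁)
    (by linear_combination -hv₁) hle
  have hzero : lyapunov A B (t.1 - (k t).1) (t.2 - (k t).2) ≤ 0 := by
    refine (hkmin t _ hc₂).trans (le_of_eq ?_)
    simp only [hu, hv, lyapunov]
    ring
  obtain ⟨h1, h2⟩ := eq_zero_of_lyapunov_nonpos hA hAB hB ((htmax s hs).trans hzero)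
  rw [sub_eq_zero] at h1 h2
  rw [h1, h2]
  exact hk s

theorem exists_natAbs_le_of_mem_diffSet (A : ℤ) {L : Set Pt} (hL : IsCompact L) :
    ∃ C : ℕ, ∀ u v : ℤ, ((u : ℝ), (v : ℝ)) ∈ diffSet A L → u.natAbs ≤ C := by
  obtain ⟨C, hC⟩ := (isCompact_diffSet A hL).isBounded.exists_norm_le
  refine ⟨⌊C⌋₊, fun u v h => Nat.le_floor ?_⟩
  rw [Nat.cast_natAbs, Int.cast_abs]
  exact (norm_fst_le _).trans (hC _ h)

theorem abs_le_one_of_mem_diffSet {A B : ℤ} (hA : -1 ≤ A) (hB : 2 ≤ B) (h2A : 2 * A < B + 3)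
    {L : Set Pt} (hLc : IsCompact L) (hL : LatEq A B L) {u v : ℤ}
    (h : ((u : ℝ), (v : ℝ)) ∈ diffSet A L) : |u| ≤ 1 := by
  obtain ⟨C, hC⟩ := exists_natAbs_le_of_mem_diffSet A hLc
  let P : ℕ → Prop := fun n => ∃ u v : ℤ, ((u : ℝ), (v : ℝ)) ∈ diffSet A L ∧ u.natAbs = n
  classical
  have hP : P (Nat.findGreatest P C) := Nat.findGreatest_spec (hC u v h) ⟨u, v, h, rfl⟩
  have hmax {u v : ℤ} (h : ((u : ℝ), (v : ℝ)) ∈ diffSet A L) :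
      u.natAbs ≤ Nat.findGreatest P C := Nat.le_findGreatest (hC u v h) ⟨u, v, h, rfl⟩
  generalize Nat.findGreatest P C = m at hP hmax
  obtain ⟨r₁, h₀⟩ : ∃ r₁ : ℤ, (((m : ℤ) : ℝ), (r₁ : ℝ)) ∈ diffSet A L := by
    obtain ⟨r₀, r₁, h₀, rfl⟩ := hP
    obtain hr | hr := Int.natAbs_eq r₀
    · exact ⟨r₁, by rwa [← hr]⟩
    · refine ⟨-r₁, ?_⟩
      rw [← neg_eq_iff_eq_neg.2 hr]
      push_cast
      exact neg_mem_diffSet h₀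
  obtain ⟨r₂, h₁, e₂⟩ := diffSet_shift hL h₀
  obtain ⟨r₃, h₂, e₃⟩ := diffSet_shift hL h₁
  obtain ⟨r₄, h₃, e₄⟩ := diffSet_shift hL h₂
  obtain ⟨r₅, h₄, -⟩ := diffSet_shift hL h₃
  have b₁ := hmax h₁
  have b₂ := hmax h₂
  have b₃ := hmax h₃
  have b₄ := hmax h₄
  rw [abs_le] at e₂ e₃ e₄
  have hm : (m : ℤ) ≤ 1 := by
    obtain hA0 | rfl : 0 ≤ A ∨ A = -1 := by omega
    · exact le_one_of_recursion (r₁ := -r₁) (r₂ := r₂) (r₃ := -r₃) (r₄ := r₄) hA0 hB h2A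
        (by omega) (by omega) (by omega) (by omega) (by linarith) (by linarith) (by linarith)
    · exact le_one_of_recursion (a := 1) (r₁ := r₁) (r₂ := r₂) (r₃ := r₃) (r₄ := r₄)
        (by omega) hB (by omega)
        (by omega) (by omega) (by omega) (by omega) (by linarith) (by linarith) (by linarith)
  have := hmax h
  rw [abs_le]
  omega

theorem exists_next_state {A B u v : ℤ} (hA : -1 ≤ A) (hAB : A ≤ B) (hB : 2 ≤ B)
    (hu : -1 ≤ u) (hu' : u ≤ 1) (hv : -1 ≤ v) (hv' : v ≤ 1) (huv : A * (u * v) ≤ 0) :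
    ∃ w : ℤ, -1 ≤ w ∧ w ≤ 1 ∧ A * (v * w) ≤ 0 ∧ |w + A * v + B * u| ≤ B - 1 := by
  obtain ⟨w, hw⟩ : ∃ w : ℤ, w = if u = 0 then (if 0 < A then -v else 0) else
    if A * v = 0 then -u else 0 := ⟨_, rfl⟩
  refine ⟨w, ?_⟩
  rw [abs_le]
  obtain rfl | rfl | rfl : u = -1 ∨ u = 0 ∨ u = 1 := by omega
  all_goals obtain rfl | rfl | rfl : v = -1 ∨ v = 0 ∨ v = 1 := by omega
  all_goals
    norm_num at hw huv
    try split_ifs at hw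
    all_goals
      subst hw
      refine ⟨?_, ?_, ?_, ?_, ?_⟩ <;> omega

/-- The integer points of the difference set, in shifted coordinates. -/
theorem mem_diffSet_iff {A B : ℤ} (hA : -1 ≤ A) (hAB : A ≤ B) (hB : 2 ≤ B)
    (h2A : 2 * A < B + 3) {L : Set Pt} (hLne : L.Nonempty) (hLc : IsCompact L)
    (hL : LatEq A B L) {u v : ℤ} :
    ((u : ℝ), (v : ℝ)) ∈ diffSet A L ↔ |u| ≤ 1 ∧ |v| ≤ 1 ∧ A * (u * v) ≤ 0 := by
  constructor
  · intro h
    obtain ⟨w, h₁, e⟩ := diffSet_shift hL h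
    obtain ⟨t, h₂, -⟩ := diffSet_shift hL h₁
    have hu := abs_le_one_of_mem_diffSet hA hB h2A hLc hL h
    have hv := abs_le_one_of_mem_diffSet hA hB h2A hLc hL h₁
    have hw := abs_le_one_of_mem_diffSet hA hB h2A hLc hL h₂
    refine ⟨hu, hv, ?_⟩
    rw [abs_le] at hu hv hw e
    obtain rfl | rfl | rfl : u = -1 ∨ u = 0 ∨ u = 1 := by omega
    all_goals obtain rfl | rfl | rfl : v = -1 ∨ v = 0 ∨ v = 1 := by omega
    all_goals omega
  · rintro ⟨hu, hv, huv⟩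
    let S : Finset (ℤ × ℤ) :=
      {s ∈ Finset.Icc (-1) 1 ×ˢ Finset.Icc (-1) 1 | A * (s.1 * s.2) ≤ 0}
    have hS : ∀ s ∈ S, ∃ w : ℤ, (s.2, w) ∈ S ∧ |w + A * s.2 + B * s.1| ≤ B - 1 := by
      rintro ⟨u, v⟩ hs
      simp only [S, Finset.mem_filter, Finset.mem_product, Finset.mem_Icc] at hs ⊢
      obtain ⟨⟨⟨hu, hu'⟩, hv, hv'⟩, huv⟩ := hs
      obtain ⟨w, h1, h2, h3, h4⟩ := exists_next_state hA hAB hB hu hu' hv hv' huv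
      exact ⟨w, ⟨⟨⟨hv, hv'⟩, h1, h2⟩, h3⟩, h4⟩
    refine mem_diffSet_of_forall_exists hA hAB hB hLne hLc hL hS (s := (u, v)) ?_
    simp only [S, Finset.mem_filter, Finset.mem_product, Finset.mem_Icc]
    exact ⟨⟨abs_le.1 hu, abs_le.1 hv⟩, huv⟩

theorem ncard_ne_zero_and {α : Type*} [Zero α] {P : α → Prop} {F : Finset α} (h0 : 0 ∉ F)
    (h : ∀ z, z ≠ 0 → (P z ↔ z ∈ F)) : {z | z ≠ 0 ∧ P z}.ncard = F.card := by
  rw [← ncard_coe_finset]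
  congr 1
  ext z
  refine (and_congr_right (h z)).trans (and_iff_right_of_imp ?_)
  rintro hz rfl
  exact h0 hz

theorem stmt_5 (A B : ℤ) (hA : -1 ≤ A) (hAB : A ≤ B) (hB : 2 ≤ B) (h2A : 2 * A < B + 3)
    (L : Set Pt) (hLne : L.Nonempty) (hLc : IsCompact L) (hL : LatEq A B L) :
    (∀ z : ℤ × ℤ, z ≠ 0 →
      ((L ∩ (fun x => x + ![(z.1:ℝ), (z.2:ℝ)]) '' L).Nonempty ↔
        ((0 < A ∧ z ∈ ({(A,1), (A-1,1), (1,0), (-1,0), (-A,-1), (-A+1,-1)} : Set (ℤ × ℤ))) ∨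
         (A = 0 ∧ z ∈ ({(1,0), (-1,0), (1,1), (-1,1), (1,-1), (-1,-1), (0,1), (0,-1)} :
            Set (ℤ × ℤ))) ∨
         (A = -1 ∧ z ∈ ({(-1,1), (0,1), (1,0), (-1,0), (1,-1), (0,-1)} : Set (ℤ × ℤ)))))) ∧
    (A ≠ 0 →
      {z : ℤ × ℤ | z ≠ 0 ∧ (L ∩ (fun x => x + ![(z.1:ℝ), (z.2:ℝ)]) '' L).Nonempty}.ncard = 6) ∧
    (A = 0 →
      {z : ℤ × ℤ | z ≠ 0 ∧ (L ∩ (fun x => x + ![(z.1:ℝ), (z.2:ℝ)]) '' L).Nonempty}.ncard = 8) := by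
  have main : ∀ z : ℤ × ℤ, z ≠ 0 →
      ((L ∩ (fun x => x + ![(z.1:ℝ), (z.2:ℝ)]) '' L).Nonempty ↔
        ((0 < A ∧ z ∈ ({(A,1), (A-1,1), (1,0), (-1,0), (-A,-1), (-A+1,-1)} : Set (ℤ × ℤ))) ∨
         (A = 0 ∧ z ∈ ({(1,0), (-1,0), (1,1), (-1,1), (1,-1), (-1,-1), (0,1), (0,-1)} :
            Set (ℤ × ℤ))) ∨
         (A = -1 ∧ z ∈ ({(-1,1), (0,1), (1,0), (-1,0), (1,-1), (0,-1)} : Set (ℤ × ℤ))))) := by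
    rintro ⟨p, q⟩ hz
    rw [inter_translate_nonempty_iff (A := A),
      mem_diffSet_iff hA hAB hB h2A hLne hLc hL]
    simp only [ne_eq, Prod.mk_eq_zero, mem_insert_iff, mem_singleton_iff, Prod.mk.injEq,
      abs_le] at hz ⊢
    obtain ⟨v, rfl⟩ : ∃ v, p = v + A * q := ⟨p - A * q, by ring⟩
    rw [add_sub_cancel_right]
    constructor
    · rintro ⟨hq, hv, hqv⟩
      have hq' : q = -1 ∨ q = 0 ∨ q = 1 := by omega
      have hv' : v = -1 ∨ v = 0 ∨ v = 1 := by omega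
      clear hq hv
      obtain hA0 | rfl | rfl : 0 < A ∨ A = 0 ∨ A = -1 := by omega
      · refine .inl ⟨hA0, ?_⟩
        rcases hq' with rfl | rfl | rfl <;> rcases hv' with rfl | rfl | rfl <;> omega
      · refine .inr (.inl ⟨rfl, ?_⟩)
        rcases hq' with rfl | rfl | rfl <;> rcases hv' with rfl | rfl | rfl <;> simp at hz ⊢
      · refine .inr (.inr ⟨rfl, ?_⟩)
        rcases hq' with rfl | rfl | rfl <;> rcases hv' with rfl | rfl | rfl <;> omega
    · rintro (⟨hA0, h⟩ | ⟨rfl, h⟩ | ⟨rfl, h⟩)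
      · rcases h with ⟨h, rfl⟩ | ⟨h, rfl⟩ | ⟨h, rfl⟩ | ⟨h, rfl⟩ | ⟨h, rfl⟩ | ⟨h, rfl⟩
        · obtain rfl : v = 0 := by omega
          omega
        · obtain rfl : v = -1 := by omega
          omega
        · omega
        · omega
        · obtain rfl : v = 0 := by omega
          omega
        · obtain rfl : v = 1 := by omega
          omega
      · omega
      · rcases h with ⟨h, rfl⟩ | ⟨h, rfl⟩ | ⟨h, rfl⟩ | ⟨h, rfl⟩ | ⟨h, rfl⟩ | ⟨h, rfl⟩
        all_goals omega
  refine ⟨main, fun hA0 => ?_, fun hA0 => ?_⟩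
  · obtain hpos | rfl : 0 < A ∨ A = -1 := by omega
    · rw [ncard_ne_zero_and
        (F := {(A,1), (A-1,1), (1,0), (-1,0), (-A,-1), (-A+1,-1)}) (by simp [Prod.ext_iff])
        fun z hz => (main z hz).trans (by simp [hpos, hA0, show A ≠ -1 by omega])]
      repeat rw [Finset.card_insert_of_notMem (by simp; try omega)]
      simp
    · rw [ncard_ne_zero_and
        (F := {(-1,1), (0,1), (1,0), (-1,0), (1,-1), (0,-1)}) (by simp [Prod.ext_iff])
        fun z hz => (main z hz).trans (by simp)]
      rfl
  · subst hA0
    rw [ncard_ne_zero_and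
      (F := {(1,0), (-1,0), (1,1), (-1,1), (1,-1), (-1,-1), (0,1), (0,-1)}) (by simp [Prod.ext_iff])
      fun z hz => (main z hz).trans (by simp)]
    rfl
end
end

section
/- Let A, B be integers with |A| ≤ B and B ≥ 2, let M be the 2×2 real matrix with rows (0, −B) and (1, −A), let T be the unique nonempty compact subset of ℝ² satisfying M·T + ((B−1)/2, 0) = (⋃_{i=0}^{B−2} (T + (i,0))) ∪ (−T), and let T^ℓ be the unique nonempty compact subset of ℝ² satisfying M·T^ℓ = ⋃_{i=0}^{B−1} (T^ℓ + (i,0)). If γ is an element of the p2 group Γ with γ ≠ id and T ∩ γ(T) ≠ ∅, then either γ is a translation x ↦ x + z with z ∈ ℤ² nonzero and T^ℓ ∩ (T^ℓ + z) ≠ ∅, or γ is a point reflection x ↦ −x + z with z ∈ ℤ² and either z = 0 or T^ℓ ∩ (T^ℓ + z) ≠ ∅. -/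
open Set Pointwise

noncomputable section

/-- A quadratic form that is expanded by the matrix `!![0, -b; 1, -a]`. -/
def lyapunovForm (a b : ℝ) (v : Pt) : ℝ :=
  b * v 0 ^ 2 - 2 * a * v 0 * v 1 + (b + 1) * v 1 ^ 2

lemma lyapunovForm_nonneg {a b : ℝ} (hab : |a| ≤ b) (v : Pt) : 0 ≤ lyapunovForm a b v := by
  obtain ⟨h₁, h₂⟩ := abs_le.mp hab
  unfold lyapunovForm
  rcases le_total 0 a with h | h
  · nlinarith [mul_nonneg h (sq_nonneg (v 0 - v 1)), sq_nonneg (v 1),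
      mul_nonneg (sub_nonneg.mpr h₂) (add_nonneg (sq_nonneg (v 0)) (sq_nonneg (v 1)))]
  · nlinarith [mul_nonneg (neg_nonneg.mpr h) (sq_nonneg (v 0 + v 1)), sq_nonneg (v 1),
      mul_nonneg (neg_le_iff_add_nonneg'.mp h₁) (add_nonneg (sq_nonneg (v 0)) (sq_nonneg (v 1)))]

lemma lyapunovForm_le {a b : ℝ} (hab : |a| ≤ b) (v : Pt) :
    lyapunovForm a b v ≤ (2 * b + 2) * (v 0 ^ 2 + v 1 ^ 2) := by
  have h := lyapunovForm_nonneg (a := -a) (b := b) (by rwa [abs_neg]) v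
  have hb : 0 ≤ b := (abs_nonneg a).trans hab
  unfold lyapunovForm at *
  nlinarith [mul_nonneg hb (sq_nonneg (v 0)), mul_nonneg hb (sq_nonneg (v 1)), sq_nonneg (v 0),
    sq_nonneg (v 1)]

lemma lyapunovForm_add_sq_le {a b : ℝ} (hab : |a| ≤ b) (hb : 2 ≤ b) {u v : Pt}
    (h0 : u 0 = -b * v 1) (h1 : u 1 = v 0 - a * v 1) :
    lyapunovForm a b v + (v 0 ^ 2 + v 1 ^ 2) ≤ lyapunovForm a b u := by
  have ha : a ^ 2 ≤ b ^ 2 := sq_le_sq' (abs_le.mp hab).1 (abs_le.mp hab).2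
  have hk : 0 ≤ b ^ 3 - b - 2 - a ^ 2 * (b - 1) := by nlinarith
  have := mul_nonneg hk (sq_nonneg (v 1))
  unfold lyapunovForm
  rw [h0, h1]
  nlinarith

lemma continuous_lyapunovForm (a b : ℝ) : Continuous (lyapunovForm a b) := by
  unfold lyapunovForm
  fun_prop

/-- A compact set `S` that is carried by `!![0, -B; 1, -A]` into the union of its translates by the
digits `0, …, B - 1` is contained in the self-affine tile with these digits. -/
lemma LatEq.subset_of_forall_exists {A B : ℤ} (hAB : |A| ≤ B) (hB : 2 ≤ B) {L : Set Pt}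
    (hLne : L.Nonempty) (hLc : IsCompact L) (hL : LatEq A B L) {S : Set Pt} (hSc : IsCompact S)
    (hS : ∀ x ∈ S, ∃ i ∈ Finset.Icc (0 : ℤ) (B - 1), ∃ s ∈ S,
      -(B : ℝ) * x 1 = s 0 + i ∧ x 0 - A * x 1 = s 1) :
    S ⊆ L := by
  have hab : |(A : ℝ)| ≤ B := by exact_mod_cast hAB
  have hb : (2 : ℝ) ≤ B := by exact_mod_cast hB
  have pullback : ∀ l ∈ L, ∀ i ∈ Finset.Icc (0 : ℤ) (B - 1), ∃ m ∈ L,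
      -(B : ℝ) * m 1 = l 0 + i ∧ m 0 - A * m 1 = l 1 := by
    intro l hl i hi
    have : l + ![(i : ℝ), 0] ∈ ⋃ i ∈ Finset.Icc (0:ℤ) (B-1), (fun x => x + ![(i:ℝ), 0]) '' L :=
      mem_biUnion hi (mem_image_of_mem _ hl)
    rw [← hL] at this
    obtain ⟨m, hm, h⟩ := this
    have h0 := congrFun h 0
    have h1 := congrFun h 1
    simp [dotProduct, Fin.sum_univ_two] at h0 h1
    exact ⟨m, hm, by linarith, by linarith⟩
  have approx : ∀ x ∈ S, ∀ l ∈ L, ∀ s ∈ S, ∀ i ∈ Finset.Icc (0 : ℤ) (B - 1),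
      -(B : ℝ) * x 1 = s 0 + i → x 0 - A * x 1 = s 1 → ∃ m ∈ L,
      lyapunovForm A B (x - m) + ((x - m) 0 ^ 2 + (x - m) 1 ^ 2) ≤ lyapunovForm A B (s - l) := by
    intro x _ l hl s _ i hi h0 h1
    obtain ⟨m, hm, h2, h3⟩ := pullback l hl i hi
    refine ⟨m, hm, lyapunovForm_add_sq_le hab hb ?_ ?_⟩ <;> simp only [Pi.sub_apply] <;> linarith
  obtain ⟨C, hC⟩ := ((hSc.prod hLc).image
    ((continuous_lyapunovForm A B).comp (continuous_fst.sub continuous_snd))).bddAbove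
  set r : ℝ := 1 + 1 / (2 * B + 2) with hr
  have hr0 : (0 : ℝ) < 2 * B + 2 := by linarith
  have hr1 : 1 < r := by rw [hr]; linarith [one_div_pos.mpr hr0]
  have decay : ∀ n : ℕ, ∀ x ∈ S, ∃ l ∈ L, r ^ n * lyapunovForm A B (x - l) ≤ C := by
    intro n
    induction n with
    | zero =>
      intro x hx
      obtain ⟨l, hl⟩ := hLne
      exact ⟨l, hl, by simpa using hC (mem_image_of_mem _ (mk_mem_prod hx hl))⟩
    | succ n ih =>
      intro x hx
      obtain ⟨i, hi, s, hs, h0, h1⟩ := hS x hx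
      obtain ⟨l, hl, hle⟩ := ih s hs
      obtain ⟨m, hm, hml⟩ := approx x hx l hl s hs i hi h0 h1
      refine ⟨m, hm, le_trans ?_ hle⟩
      rw [pow_succ, mul_assoc]
      refine mul_le_mul_of_nonneg_left (le_trans ?_ hml) (by positivity)
      have := (div_le_iff₀' hr0).mpr (lyapunovForm_le hab (x - m))
      rw [hr, add_mul, one_mul, one_div_mul_eq_div]
      linarith
  intro x hx
  rw [← hLc.isClosed.closure_eq, Metric.mem_closure_iff]
  intro δ hδ
  obtain ⟨n, hn⟩ := pow_unbounded_of_one_lt (C / δ ^ 2) hr1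
  obtain ⟨i, hi, s, hs, h0, h1⟩ := hS x hx
  obtain ⟨l, hl, hle⟩ := decay n s hs
  obtain ⟨m, hm, hml⟩ := approx x hx l hl s hs i hi h0 h1
  have hsq : (x - m) 0 ^ 2 + (x - m) 1 ^ 2 < δ ^ 2 := by
    have hpos : 0 < r ^ n := by positivity
    have h2 : lyapunovForm A B (s - l) < δ ^ 2 := by
      rw [div_lt_iff₀ (by positivity)] at hn
      exact lt_of_mul_lt_mul_left (hle.trans_lt hn) hpos.le
    linarith [lyapunovForm_nonneg hab (x - m)]
  refine ⟨m, hm, ?_⟩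
  rw [dist_pi_lt_iff hδ, Fin.forall_fin_two, Real.dist_eq, Real.dist_eq]
  simp only [Pi.sub_apply] at hsq
  exact ⟨abs_lt_of_sq_lt_sq (by nlinarith [sq_nonneg (x 1 - m 1)]) hδ.le,
    abs_lt_of_sq_lt_sq (by nlinarith [sq_nonneg (x 0 - m 0)]) hδ.le⟩

/-- The crystallographic tile and its point reflection lie in one translate of the lattice tile. -/
lemma CrysEq.exists_translate_subset {A B : ℤ} (hAB : |A| ≤ B) (hB : 2 ≤ B)
    {T : Set Pt} (hTc : IsCompact T) (hT : CrysEq A B T)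
    {L : Set Pt} (hLne : L.Nonempty) (hLc : IsCompact L) (hL : LatEq A B L) :
    ∃ w : Pt, ∀ x ∈ T, x + w ∈ L ∧ -x + w ∈ L := by
  have hdet : (0 : ℝ) < B + A + 1 := by
    have : 0 < B + A + 1 := by linarith [(abs_le.mp hAB).1]
    exact_mod_cast this
  obtain ⟨w₁, hw₁⟩ : ∃ w₁ : ℝ, (B + A + 1) * w₁ = -((B - 1) / 2) :=
    ⟨_, mul_div_cancel₀ _ hdet.ne'⟩
  set w : Pt := ![(A + 1) * w₁, w₁] with hw
  have hw0 : w 0 = (A + 1) * w₁ := rfl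
  have hw1 : w 1 = w₁ := rfl
  have step : ∀ x ∈ T, ∃ y ∈ T,
      (∃ i ∈ Finset.Icc (0 : ℤ) (B - 2),
        -(B : ℝ) * x 1 + (B - 1) / 2 = y 0 + i ∧ x 0 - A * x 1 = y 1) ∨
      (-(B : ℝ) * x 1 + (B - 1) / 2 = -y 0 ∧ x 0 - A * x 1 = -y 1) := by
    intro x hx
    have := hT ▸ mem_image_of_mem
      (fun x => (!![0, -(B:ℝ); 1, -(A:ℝ)]).mulVec x + ![((B:ℝ)-1)/2, 0]) hx
    rcases this with h | h
    · simp only [mem_iUnion] at h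
      obtain ⟨i, hi, y, hy, h⟩ := h
      have h0 := congrFun h 0
      have h1 := congrFun h 1
      simp [dotProduct, Fin.sum_univ_two] at h0 h1
      exact ⟨y, hy, .inl ⟨i, hi, by linarith, by linarith⟩⟩
    · refine ⟨_, h, .inr ?_⟩
      simp [dotProduct, Fin.sum_univ_two]
      ring
  have hsub : (fun x => x + w) '' (T ∪ -T) ⊆ L := by
    refine hL.subset_of_forall_exists hAB hB hLne hLc
      ((hTc.union hTc.neg).image (continuous_id.add continuous_const)) ?_
    rintro _ ⟨x, hx | hx, rfl⟩
    · obtain ⟨y, hy, ⟨i, hi, h0, h1⟩ | ⟨h0, h1⟩⟩ := step x hx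
      · refine ⟨i, ?_, y + w, mem_image_of_mem _ (.inl hy), ?_, ?_⟩
        · simp only [Finset.mem_Icc] at hi ⊢; lia
        · simp only [Pi.add_apply, hw0, hw1]; linarith
        · simp only [Pi.add_apply, hw0, hw1]; linarith
      · refine ⟨0, ?_, -y + w, mem_image_of_mem _ (.inr (by simpa using hy)), ?_, ?_⟩
        · simp only [Finset.mem_Icc]; lia
        · simp only [Pi.add_apply, Pi.neg_apply, hw0, hw1]; push_cast; linarith
        · simp only [Pi.add_apply, Pi.neg_apply, hw0, hw1]; linarith
    · obtain ⟨y, hy, ⟨i, hi, h0, h1⟩ | ⟨h0, h1⟩⟩ := step (-x) hx <;>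
        simp only [Pi.neg_apply] at h0 h1
      · refine ⟨B - 1 - i, ?_, -y + w, mem_image_of_mem _ (.inr (by simpa using hy)), ?_, ?_⟩
        · simp only [Finset.mem_Icc] at hi ⊢; lia
        · simp only [Pi.add_apply, Pi.neg_apply, hw0, hw1]; push_cast; linarith
        · simp only [Pi.add_apply, Pi.neg_apply, hw0, hw1]; linarith
      · refine ⟨B - 1, ?_, y + w, mem_image_of_mem _ (.inl hy), ?_, ?_⟩
        · simp only [Finset.mem_Icc]; lia
        · simp only [Pi.add_apply, hw0, hw1]; push_cast; linarith
        · simp only [Pi.add_apply, hw0, hw1]; linarith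
  exact ⟨w, fun x hx => ⟨hsub (mem_image_of_mem _ (.inl hx)),
    hsub (mem_image_of_mem _ (.inr (by simpa using hx)))⟩⟩

theorem stmt_6 (A B : ℤ) (hAB : |A| ≤ B) (hB : 2 ≤ B)
    (T : Set Pt) (hTne : T.Nonempty) (hTc : IsCompact T) (hT : CrysEq A B T)
    (L : Set Pt) (hLne : L.Nonempty) (hLc : IsCompact L) (hL : LatEq A B L) :
    ∀ (ε : ℝ) (p q : ℤ), (ε = 1 ∨ ε = -1) →
      (fun x : Pt => ε • x + ![(p:ℝ), (q:ℝ)]) ≠ id →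
      (T ∩ (fun x : Pt => ε • x + ![(p:ℝ), (q:ℝ)]) '' T).Nonempty →
      (ε = 1 ∧ ¬(p = 0 ∧ q = 0) ∧
        (L ∩ (fun x => x + ![(p:ℝ), (q:ℝ)]) '' L).Nonempty) ∨
      (ε = -1 ∧ ((p = 0 ∧ q = 0) ∨
        (L ∩ (fun x => x + ![(p:ℝ), (q:ℝ)]) '' L).Nonempty)) := by
  rintro ε p q hε hne ⟨x, hx, y, hy, hxy⟩
  obtain ⟨w, hw⟩ := hT.exists_translate_subset hAB hB hTc hLne hLc hL
  rcases hε with rfl | rfl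
  · refine .inl ⟨rfl, ?_, x + w, (hw x hx).1, y + w, (hw y hy).1, ?_⟩
    · rintro ⟨rfl, rfl⟩
      refine hne (funext fun x => ?_)
      ext j
      fin_cases j <;> simp
    · simp only [← hxy, one_smul]
      abel
  · refine .inr ⟨rfl, .inr ⟨x + w, (hw x hx).1, -y + w, (hw y hy).2, ?_⟩⟩
    simp only [← hxy, neg_smul, one_smul]
    abel
end
end

section
/- Let K be a compact subset of ℝ² equal to the closure of its interior, with nonempty interior, and suppose that the family {γ(K) : γ ∈ Γ} is a tiling of the plane, i.e. ⋃_{γ ∈ Γ} γ(K) = ℝ² and for any two distinct γ, γ′ ∈ Γ the interiors of γ(K) and γ′(K) are disjoint, where Γ is the p2 group. Then the neighbor set {γ ∈ Γ : γ ≠ id and K ∩ γ(K) ≠ ∅} has at least six elements. -/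
open Set Pointwise

noncomputable section

section Topology

variable {E : Type*} [NormedAddCommGroup E] [NormedSpace ℝ E]

theorem isPreconnected_compl_closedBall (hE : 1 < Module.rank ℝ E) (c : E) {R : ℝ} (hR : 0 ≤ R) :
    IsPreconnected (Metric.closedBall c R)ᶜ := by
  have himage : (Metric.closedBall c R)ᶜ
      = (fun z : E × ℝ => c + z.2 • z.1) '' (Metric.sphere (0 : E) 1 ×ˢ Ioi R) := by
    ext x
    simp only [mem_compl_iff, Metric.mem_closedBall, not_le, mem_image, mem_prod,
      mem_sphere_iff_norm, sub_zero, mem_Ioi, Prod.exists, dist_eq_norm]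
    constructor
    · intro hx
      have h0 : ‖x - c‖ ≠ 0 := (hR.trans_lt hx).ne'
      refine ⟨‖x - c‖⁻¹ • (x - c), ‖x - c‖, ⟨?_, hx⟩, ?_⟩
      · rw [norm_smul, norm_inv, norm_norm, inv_mul_cancel₀ h0]
      · rw [smul_smul, mul_inv_cancel₀ h0, one_smul, add_sub_cancel]
    · rintro ⟨y, t, ⟨hy, ht⟩, rfl⟩
      rw [add_sub_cancel_left, norm_smul, hy, mul_one, Real.norm_eq_abs]
      exact ht.trans_le (le_abs_self t)
  rw [himage]
  exact ((isPreconnected_sphere hE 0 1).prod isPreconnected_Ioi).image _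
    (by fun_prop : Continuous fun z : E × ℝ => c + z.2 • z.1).continuousOn

theorem IsPreconnected.eq_of_mem_zmultiples {X : Type*} [TopologicalSpace X] {s : Set X}
    (hs : IsPreconnected s) {h : X → ℝ} (hc : ContinuousOn h s)
    (hint : ∀ x ∈ s, h x ∈ AddSubgroup.zmultiples (1 : ℝ)) {x y : X} (hx : x ∈ s) (hy : y ∈ s) :
    h x = h y :=
  hs.constant_of_mapsTo (T := (AddSubgroup.zmultiples (1 : ℝ) : Set ℝ))
    (SetLike.isDiscrete_iff_discreteTopology.2 inferInstance) hc hint hx hy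

theorem exists_notMem_of_isBounded (hE : 1 < Module.rank ℝ E) {s : Set E}
    (hs : Bornology.IsBounded s) : ∃ y, y ∉ s := by
  have : Nontrivial E := (rank_pos_iff_nontrivial (R := ℝ)).1 (zero_lt_one.trans hE)
  by_contra! hall
  exact NormedSpace.unbounded_univ ℝ E (eq_univ_of_forall hall ▸ hs)

/-- A continuous function that is integral outside a ball and vanishes far away vanishes outside
the ball. -/
theorem eq_zero_of_notMem_closedBall (hE : 1 < Module.rank ℝ E) {h : E → ℝ} (hc : Continuous h)
    (hsupp : HasCompactSupport h) {c : E} {R : ℝ} (hR : 0 ≤ R)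
    (hint : ∀ x ∉ Metric.closedBall c R, h x ∈ AddSubgroup.zmultiples (1 : ℝ)) {x : E}
    (hx : x ∉ Metric.closedBall c R) : h x = 0 := by
  obtain ⟨y, hy⟩ := exists_notMem_of_isBounded hE
    (hsupp.isCompact.isBounded.union (Metric.isBounded_closedBall (x := c) (r := R)))
  rw [mem_union, not_or] at hy
  rw [(isPreconnected_compl_closedBall hE c hR).eq_of_mem_zmultiples hc.continuousOn hint hx hy.2]
  exact image_eq_zero_of_notMem_tsupport hy.1

/-- If `u` takes integral values on the frontier of a bounded set `U`, then modulo `1` the function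
equal to `u` on `U` and to `0` elsewhere lifts to a compactly supported continuous function. -/
theorem exists_hasCompactSupport_lift [FiniteDimensional ℝ E] (hE : 1 < Module.rank ℝ E)
    {u : E → ℝ} (hu : Continuous u) {U : Set E} (hU : Bornology.IsBounded U)
    (hfr : ∀ x ∈ frontier U, u x ∈ AddSubgroup.zmultiples (1 : ℝ)) :
    ∃ h : E → ℝ, Continuous h ∧ HasCompactSupport h ∧
      ∀ x, h x - U.indicator u x ∈ AddSubgroup.zmultiples (1 : ℝ) := by
  classical
  have hf : Continuous fun x => ((U.indicator u x : ℝ) : AddCircle (1 : ℝ)) := by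
    have : (fun x => ((U.indicator u x : ℝ) : AddCircle (1 : ℝ)))
        = fun x => if x ∈ U then (u x : AddCircle (1 : ℝ)) else 0 := by
      ext x
      by_cases hx : x ∈ U <;> simp [hx]
    rw [this]
    refine Continuous.if (fun x hx => ?_) ((AddCircle.continuous_mk' 1).comp hu) continuous_const
    exact (QuotientAddGroup.eq_zero_iff _).2 (hfr x hx)
  obtain ⟨R, hR, hUR⟩ := hU.subset_closedBall_lt 0 0
  obtain ⟨F, ⟨-, hF⟩, -⟩ := (AddCircle.isCoveringMap_coe (1 : ℝ)).existsUnique_continuousMap_lifts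
    ⟨_, hf⟩ (0 : E) (U.indicator u 0) rfl
  have hFint : ∀ x, F x - U.indicator u x ∈ AddSubgroup.zmultiples (1 : ℝ) := fun x => by
    rw [← QuotientAddGroup.eq_iff_sub_mem]
    exact congrFun hF x
  have hFint' : ∀ x ∉ Metric.closedBall (0 : E) R, F x ∈ AddSubgroup.zmultiples (1 : ℝ) :=
    fun x hx => by simpa [indicator_of_notMem fun h => hx (hUR h)] using hFint x
  obtain ⟨y, hy⟩ := exists_notMem_of_isBounded hE
    (Metric.isBounded_closedBall (x := (0 : E)) (r := R))
  refine ⟨fun x => F x - F y, by fun_prop, ?_, fun x => ?_⟩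
  · refine HasCompactSupport.intro (isCompact_closedBall (0 : E) R) fun x hx => sub_eq_zero.2 ?_
    exact (isPreconnected_compl_closedBall hE 0 hR.le).eq_of_mem_zmultiples
      F.continuous.continuousOn hFint' hx hy
  · rw [sub_right_comm]
    exact sub_mem (hFint x) (hFint' y hy)

end Topology

section Tiling

variable {E : Type*} [NormedAddCommGroup E] {G : Type*} [Group G] [MulAction G E]

theorem exists_thickening_inter_smul_imp [IsIsometricSMul G E]
    (hlf : ∀ R : ℝ, {γ : G | ‖γ • (0 : E)‖ ≤ R}.Finite) {K : Set E} (hK : IsCompact K) :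
    ∃ ε > 0, ∀ γ : G, (Metric.thickening ε K ∩ γ • Metric.thickening ε K).Nonempty →
      (K ∩ γ • K).Nonempty := by
  obtain ⟨R, hR⟩ := hK.isBounded.subset_closedBall 0
  have hsmul : ∀ (γ : G) (ε : ℝ),
      γ • Metric.thickening ε K ⊆ Metric.thickening ε (γ • K) := by
    rintro γ ε _ ⟨x, hx, rfl⟩
    obtain ⟨k, hk, hxk⟩ := Metric.mem_thickening_iff.1 hx
    exact Metric.mem_thickening_iff.2 ⟨γ • k, smul_mem_smul_set hk, by simpa [dist_smul] using hxk⟩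
  have hev : ∀ γ : G, ∀ᶠ ε in nhdsWithin (0 : ℝ) (Ioi 0),
      (Metric.thickening ε K ∩ γ • Metric.thickening ε K).Nonempty → (K ∩ γ • K).Nonempty := by
    intro γ
    by_cases hγ : (K ∩ γ • K).Nonempty
    · exact Filter.Eventually.of_forall fun _ _ => hγ
    · rw [not_nonempty_iff_eq_empty, ← disjoint_iff_inter_eq_empty] at hγ
      obtain ⟨δ, hδ, hdis⟩ := hγ.exists_thickenings hK (hK.smul γ).isClosed
      filter_upwards [Ioo_mem_nhdsGT hδ] with ε hε hne
      obtain ⟨x, hx1, hx2⟩ := hne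
      exact absurd (Metric.thickening_mono hε.2.le _ (hsmul γ ε hx2))
        (disjoint_left.1 hdis (Metric.thickening_mono hε.2.le _ hx1))
  obtain ⟨ε, ⟨hεpos, hε1⟩, hε⟩ := (Filter.Eventually.and
    (Ioo_mem_nhdsGT (one_pos : (0 : ℝ) < 1))
    ((Filter.eventually_all_finite (hlf (2 * R + 2))).2 fun γ _ => hev γ)).exists
  refine ⟨ε, hεpos, fun γ hne => hε γ ?_ hne⟩
  obtain ⟨x, hx1, hx2⟩ := hne
  obtain ⟨k, hk, hxk⟩ := Metric.mem_thickening_iff.1 hx1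
  obtain ⟨_, ⟨l, hl, rfl⟩, hxl⟩ := Metric.mem_thickening_iff.1 (hsmul γ ε hx2)
  have h1 : dist k 0 ≤ R := hR hk
  have h2 : dist (γ • l) (γ • (0 : E)) ≤ R := by simpa [dist_smul] using hR hl
  rw [mem_ofPred_eq, ← dist_zero_right]
  have h4 := dist_triangle (γ • (0 : E)) (γ • l) 0
  have h5 := dist_triangle (γ • l) x 0
  have h6 := dist_triangle x k 0
  simp only at hxl
  rw [dist_comm] at h2 hxl
  linarith

variable [NormedSpace ℝ E]

/-- The regions where two translates of `N`, one indexed by `A` and one by its complement, overlap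
cannot be pairwise disjoint when they carry all the non-integral values of a function `u` with
`u (g • x) = 1 - u x`, where `g` swaps `A` with its complement. -/
theorem not_pairwise_disjoint_overlaps [FiniteDimensional ℝ E] (hE : 1 < Module.rank ℝ E)
    [IsIsometricSMul G E] (hlf : ∀ R : ℝ, {γ : G | ‖γ • (0 : E)‖ ≤ R}.Finite)
    {N : Set E} (hN : IsOpen N) (hNb : Bornology.IsBounded N)
    {A : Set G} {g : G} (hg : ∀ γ, g * γ ∈ A ↔ γ ∉ A)
    {u : E → ℝ} (hu : Continuous u) (hug : ∀ x, u (g • x) = 1 - u x)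
    (huN : ∀ x, u x ∈ AddSubgroup.zmultiples (1 : ℝ) ∨
      ∃ γ ∈ A, ∃ δ ∉ A, x ∈ γ • N ∧ x ∈ δ • N) :
    ∃ γ ∈ A, ∃ δ ∉ A, ∃ γ' ∈ A, ∃ δ' ∉ A, (γ ≠ γ' ∨ δ ≠ δ') ∧
      ∃ x, x ∈ γ • N ∧ x ∈ δ • N ∧ x ∈ γ' • N ∧ x ∈ δ' • N := by
  classical
  by_contra hdisj
  let U : G × G → Set E := fun i => {x | i.1 ∈ A ∧ i.2 ∉ A ∧ x ∈ i.1 • N ∧ x ∈ i.2 • N}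
  have hUopen : ∀ i, IsOpen (U i) := fun i => by
    simp only [U, ofPred_and]
    exact isOpen_const.inter (isOpen_const.inter ((hN.smul _).inter (hN.smul _)))
  have hUeq : ∀ i j x, x ∈ U i → x ∈ U j → i = j := by
    rintro ⟨γ, δ⟩ ⟨γ', δ'⟩ x ⟨h1, h2, h3, h4⟩ ⟨h5, h6, h7, h8⟩
    by_contra hne
    refine hdisj ⟨γ, h1, δ, h2, γ', h5, δ', h6, ?_, x, h3, h4, h7, h8⟩
    rwa [Prod.mk.injEq, not_and_or] at hne
  obtain ⟨R, hR, hNR⟩ := hNb.subset_closedBall_lt 0 0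
  have hball : ∀ (γ : G) x, x ∈ γ • N → x ∈ Metric.closedBall (γ • (0 : E)) R := by
    rintro γ _ ⟨y, hy, rfl⟩
    simpa [Metric.mem_closedBall, dist_smul] using hNR hy
  have hU1 : ∀ i, U i ⊆ Metric.closedBall (i.1 • (0 : E)) R := fun i x hx => hball _ _ hx.2.2.1
  have hU2 : ∀ i, U i ⊆ Metric.closedBall (i.2 • (0 : E)) R := fun i x hx => hball _ _ hx.2.2.2
  have hfr : ∀ i, ∀ x ∈ frontier (U i), u x ∈ AddSubgroup.zmultiples (1 : ℝ) := by
    intro i x hx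
    refine (huN x).resolve_right ?_
    rintro ⟨γ, hγ, δ, hδ, h1, h2⟩
    have hxU : x ∈ U (γ, δ) := ⟨hγ, hδ, h1, h2⟩
    obtain ⟨y, hy, hy'⟩ := mem_closure_iff.1 hx.1 _ (hUopen _) hxU
    rw [(hUopen i).frontier_eq] at hx
    exact hx.2 (hUeq _ _ y hy hy' ▸ hxU)
  choose h hc hsupp hint using fun i =>
    exists_hasCompactSupport_lift hE hu (Metric.isBounded_closedBall.subset (hU1 i)) (hfr i)
  have hzero : ∀ i c, U i ⊆ Metric.closedBall c R → ∀ x ∉ Metric.closedBall c R, h i x = 0 :=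
    fun i c hic x hx => eq_zero_of_notMem_closedBall hE (hc i) (hsupp i) hR.le
      (fun y hy => by simpa [indicator_of_notMem fun h => hy (hic h)] using hint i y) hx
  have hnear : ∀ i x, h i x ≠ 0 → ‖i.1 • (0 : E)‖ ≤ ‖x‖ + R ∧ ‖i.2 • (0 : E)‖ ≤ ‖x‖ + R := by
    intro i x hx
    have key : ∀ c, U i ⊆ Metric.closedBall c R → ‖c‖ ≤ ‖x‖ + R := fun c hic => by
      have hxc : x ∈ Metric.closedBall c R := not_not.1 fun hxc => hx (hzero i c hic x hxc)
      rw [Metric.mem_closedBall, dist_eq_norm, norm_sub_rev] at hxc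
      linarith [norm_sub_norm_le c x]
    exact ⟨key _ (hU1 i), key _ (hU2 i)⟩
  have hfin : ∀ x, (Function.support fun i => h i x).Finite := fun x =>
    ((hlf (‖x‖ + R)).prod (hlf (‖x‖ + R))).subset fun i hi => hnear i x hi
  have hlocfin : LocallyFinite fun i => Function.support (h i) := by
    intro x
    refine ⟨Metric.ball x 1, Metric.ball_mem_nhds x one_pos,
      ((hlf (‖x‖ + 1 + R)).prod (hlf (‖x‖ + 1 + R))).subset ?_⟩
    rintro i ⟨y, hy, hyx⟩
    have hy' : ‖y‖ ≤ ‖x‖ + 1 := by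
      rw [Metric.mem_ball, dist_eq_norm] at hyx
      linarith [norm_sub_norm_le y x]
    obtain ⟨h1, h2⟩ := hnear i y hy
    exact ⟨h1.trans (by linarith), h2.trans (by linarith)⟩
  let H : E → ℝ := fun x => ∑ᶠ i, h i x
  have hHc : Continuous H := continuous_finsum hc hlocfin
  have hHint : ∀ x, H x - u x ∈ AddSubgroup.zmultiples (1 : ℝ) := by
    intro x
    by_cases hx : ∃ j, x ∈ U j
    · obtain ⟨j, hj⟩ := hx
      have hH : H x = ∑ i ∈ insert j (hfin x).toFinset, h i x :=
        finsum_eq_sum_of_support_subset _ fun i hi => by simp [Function.mem_support.1 hi]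
      have hsum : u x = ∑ i ∈ insert j (hfin x).toFinset, (U i).indicator u x := by
        rw [Finset.sum_eq_single j, indicator_of_mem hj]
        · exact fun i _ hij => indicator_of_notMem (fun hi => hij (hUeq _ _ x hi hj)) _
        · simp
      rw [hH, hsum, ← Finset.sum_sub_distrib]
      exact sum_mem fun i _ => hint i x
    · have hux : u x ∈ AddSubgroup.zmultiples (1 : ℝ) := (huN x).resolve_right
        fun ⟨γ, hγ, δ, hδ, h1, h2⟩ => hx ⟨(γ, δ), hγ, hδ, h1, h2⟩
      refine sub_mem (finsum_induction (· ∈ AddSubgroup.zmultiples (1 : ℝ)) (zero_mem _)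
        (fun _ _ => add_mem) fun i => ?_) hux
      simpa [indicator_of_notMem fun hi => hx ⟨i, hi⟩] using hint i x
  let e : G × G ≃ G × G :=
    (Equiv.prodComm G G).trans ((Equiv.mulLeft g).prodCongr (Equiv.mulLeft g))
  have he : ∀ i x, g • x ∈ U (e i) ↔ x ∈ U i := by
    rintro ⟨γ, δ⟩ x
    simp only [U, e, Equiv.trans_apply, Equiv.prodComm_apply, Prod.swap_prod_mk,
      Equiv.prodCongr_apply, Prod.map_apply, Equiv.coe_mulLeft, mem_ofPred_eq, hg, mul_smul,
      smul_mem_smul_set_iff, not_not]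
    tauto
  have hanti : ∀ i x, h (e i) (g • x) = -h i x := by
    intro i x
    have hsumc : Continuous fun x => h (e i) (g • x) + h i x :=
      ((hc _).comp (continuous_const_smul g)).add (hc i)
    have hsumint : ∀ x, h (e i) (g • x) + h i x ∈ AddSubgroup.zmultiples (1 : ℝ) := by
      intro x
      have h1 := add_mem (hint (e i) (g • x)) (hint i x)
      by_cases hx : x ∈ U i
      · rw [indicator_of_mem hx, indicator_of_mem ((he i x).2 hx), hug] at h1
        have h2 := add_mem h1 (AddSubgroup.mem_zmultiples (1 : ℝ))
        convert! h2 using 1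
        ring
      · rwa [indicator_of_notMem hx, indicator_of_notMem (mt (he i x).1 hx), sub_zero,
          sub_zero] at h1
    have hsumsupp : HasCompactSupport fun x => h (e i) (g • x) + h i x :=
      ((hsupp (e i)).comp_homeomorph (Homeomorph.smul g)).add (hsupp i)
    obtain ⟨y, hy⟩ := exists_notMem_of_isBounded hE hsumsupp.isCompact.isBounded
    have h3 := isPreconnected_univ.eq_of_mem_zmultiples hsumc.continuousOn
      (fun x _ => hsumint x) (mem_univ x) (mem_univ y)
    rw [image_eq_zero_of_notMem_tsupport hy] at h3
    exact eq_neg_of_add_eq_zero_left h3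
  have hHg : H (g • (0 : E)) = -H 0 := by
    simp only [H]
    rw [← finsum_comp_equiv e, ← finsum_neg_distrib]
    exact finsum_congr fun i => hanti i 0
  have hconst := isPreconnected_univ.eq_of_mem_zmultiples (hHc.sub hu).continuousOn
      (fun x _ => hHint x) (mem_univ (g • (0 : E))) (mem_univ 0)
  rw [Pi.sub_apply, Pi.sub_apply, hHg, hug] at hconst
  obtain ⟨n, hn⟩ := AddSubgroup.mem_zmultiples_iff.1 (hHint 0)
  have hn' : (2 * n : ℝ) = -1 := by
    rw [zsmul_eq_mul, mul_one] at hn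
    linarith
  have : 2 * n = -1 := by exact_mod_cast hn'
  omega

/-- In a locally finite cover of `E` by the translates of a compact set, every nontrivial
homomorphism to `ZMod 2` is detected by three pairwise intersecting translates. -/
theorem exists_triangle [FiniteDimensional ℝ E] (hE : 1 < Module.rank ℝ E)
    [IsIsometricSMul G E] (hlf : ∀ R : ℝ, {γ : G | ‖γ • (0 : E)‖ ≤ R}.Finite)
    {K : Set E} (hK : IsCompact K) (hcover : ⋃ γ : G, γ • K = univ)
    {ψ : G → ZMod 2} (hψ : ∀ a b, ψ (a * b) = ψ a + ψ b) {g : G} (hg : ψ g = 1) :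
    ∃ a b, a ≠ b ∧ ψ a = 1 ∧ ψ b = 1 ∧ (K ∩ a • K).Nonempty ∧ (K ∩ b • K).Nonempty ∧
      (a • K ∩ b • K).Nonempty := by
  obtain ⟨ε, hε, hεK⟩ := exists_thickening_inter_smul_imp hlf hK
  have hKne : K.Nonempty := by
    by_contra hempty
    rw [not_nonempty_iff_eq_empty] at hempty
    simp only [hempty, smul_set_empty, iUnion_empty] at hcover
    exact empty_ne_univ hcover
  have h01 : ∀ z : ZMod 2, z ≠ 0 ↔ z = 1 := by decide
  have h110 : (1 : ZMod 2) + 1 = 0 := by decide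
  have hψ1 : ψ 1 = 0 := by simpa using hψ 1 1
  have hψinv : ∀ a, ψ a⁻¹ = ψ a := fun a => by
    have h := hψ a⁻¹ a
    rw [inv_mul_cancel, hψ1] at h
    exact (by decide : ∀ y z : ZMod 2, 0 = y + z → y = z) _ _ h
  let A : Set G := {γ | ψ γ = 0}
  have hgA : ∀ γ, g * γ ∈ A ↔ γ ∉ A := fun γ => by
    simp only [A, mem_ofPred_eq, hψ, hg]
    generalize ψ γ = z
    revert z
    decide
  let S : Set E := ⋃ γ ∈ A, γ • K
  let T : Set E := ⋃ γ ∈ Aᶜ, γ • K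
  have hSne : S.Nonempty :=
    hKne.mono fun x hx => mem_biUnion (x := (1 : G)) hψ1 (by rwa [one_smul])
  have hTne : T.Nonempty := (hKne.smul_set (a := g)).mono fun x hx =>
    mem_biUnion (x := g) (by simp [A, hg]) hx
  have hST : ∀ x, x ∈ S ∨ x ∈ T := fun x => by
    obtain ⟨γ, hγ⟩ := mem_iUnion.1 (hcover.symm ▸ mem_univ x)
    by_cases hA : γ ∈ A
    · exact .inl (mem_biUnion hA hγ)
    · exact .inr (mem_biUnion (show γ ∈ Aᶜ from hA) hγ)
  have hgS : g • S = T := by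
    ext x
    simp only [S, T, mem_smul_set_iff_inv_smul_mem, mem_iUnion, exists_prop, mem_compl_iff]
    constructor
    · rintro ⟨γ, hγ, hx⟩
      exact ⟨g * γ, by rw [hgA, not_not]; exact hγ, by rwa [mul_inv_rev, mul_smul]⟩
    · rintro ⟨γ, hγ, hx⟩
      refine ⟨g⁻¹ * γ, ?_, by rwa [mul_inv_rev, inv_inv, mul_smul, smul_inv_smul]⟩
      by_contra hA
      exact hγ (by simpa using (hgA _).2 hA)
  have hgT : g • T = S := by
    ext x
    simp only [S, T, mem_smul_set_iff_inv_smul_mem, mem_iUnion, exists_prop, mem_compl_iff]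
    constructor
    · rintro ⟨γ, hγ, hx⟩
      exact ⟨g * γ, (hgA _).2 hγ, by rwa [mul_inv_rev, mul_smul]⟩
    · rintro ⟨γ, hγ, hx⟩
      exact ⟨g⁻¹ * γ, by rw [← hgA]; simpa using hγ,
        by rwa [mul_inv_rev, inv_inv, mul_smul, smul_inv_smul]⟩
  have hdist : ∀ (X : Set E) x, Metric.infDist (g • x) (g • X) = Metric.infDist x X :=
    fun X x => Metric.infDist_image (isometry_smul E g)
  let t : E → ℝ := fun x => (Metric.infDist x S - Metric.infDist x T) / (2 * ε)
  have htg : ∀ x, t (g • x) = -t x := fun x => by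
    simp only [t]
    rw [← hdist S x, ← hdist T x, hgS, hgT]
    ring
  let u : E → ℝ := fun x => max 0 (min 1 (1 / 2 + t x))
  have hu : Continuous u := by
    have h1 := Metric.continuous_infDist_pt S
    have h2 := Metric.continuous_infDist_pt T
    fun_prop
  have hug : ∀ x, u (g • x) = 1 - u x := fun x => by
    simp only [u, htg]
    grind
  have huN : ∀ x, u x ∈ AddSubgroup.zmultiples (1 : ℝ) ∨ ∃ γ ∈ A, ∃ δ ∉ A,
      x ∈ γ • Metric.thickening ε K ∧ x ∈ δ • Metric.thickening ε K := by
    intro x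
    by_cases h1 : 1 / 2 ≤ t x
    · left
      have : u x = 1 := by simp only [u]; grind
      rw [this]
      exact AddSubgroup.mem_zmultiples 1
    by_cases h2 : t x ≤ -(1 / 2)
    · left
      have : u x = 0 := by simp only [u]; grind
      rw [this]
      exact zero_mem _
    right
    rw [not_le, div_lt_iff₀ (by positivity)] at h1
    rw [not_le, lt_div_iff₀ (by positivity)] at h2
    have hS : Metric.infDist x S < ε := by
      rcases hST x with hx | hx
      · rwa [Metric.infDist_zero_of_mem hx]
      · rw [Metric.infDist_zero_of_mem hx] at h1
        linarith
    have hT : Metric.infDist x T < ε := by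
      rcases hST x with hx | hx
      · rw [Metric.infDist_zero_of_mem hx] at h2
        linarith
      · rwa [Metric.infDist_zero_of_mem hx]
    have hmem : ∀ γ : G, ∀ y ∈ γ • K, dist x y < ε → x ∈ γ • Metric.thickening ε K := by
      rintro γ _ ⟨k, hk, rfl⟩ hxk
      refine mem_smul_set_iff_inv_smul_mem.2 (Metric.mem_thickening_iff.2 ⟨k, hk, ?_⟩)
      rwa [← dist_smul γ, smul_inv_smul]
    obtain ⟨y, hy, hxy⟩ := (Metric.infDist_lt_iff hSne).1 hS
    obtain ⟨z, hz, hxz⟩ := (Metric.infDist_lt_iff hTne).1 hT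
    obtain ⟨γ, hγ, hyγ⟩ := mem_iUnion₂.1 hy
    obtain ⟨δ, hδ, hzδ⟩ := mem_iUnion₂.1 hz
    exact ⟨γ, hγ, δ, hδ, hmem γ y hyγ hxy, hmem δ z hzδ hxz⟩
  obtain ⟨γ, hγ, δ, hδ, γ', hγ', δ', hδ', hne, x, h1, h2, h3, h4⟩ :=
    not_pairwise_disjoint_overlaps hE hlf Metric.isOpen_thickening hK.isBounded.thickening hgA hu
      hug huN
  have hadj : ∀ c a : G, x ∈ c • Metric.thickening ε K → x ∈ a • Metric.thickening ε K →
      (K ∩ (c⁻¹ * a) • K).Nonempty := fun c a hc ha =>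
    hεK _ ⟨c⁻¹ • x, mem_smul_set_iff_inv_smul_mem.1 hc, by
      rw [mul_smul]
      exact smul_mem_smul_set ha⟩
  have hadj' : ∀ c a b : G, x ∈ a • Metric.thickening ε K → x ∈ b • Metric.thickening ε K →
      ((c⁻¹ * a) • K ∩ (c⁻¹ * b) • K).Nonempty := fun c a b ha hb => by
    have h := (hadj a b ha hb).smul_set (a := c⁻¹ * a)
    rwa [smul_set_inter, smul_smul, mul_assoc, mul_inv_cancel_left] at h
  simp only [A, mem_ofPred_eq, h01] at hγ hδ hγ' hδ'
  rcases hne with hne | hne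
  · exact ⟨δ⁻¹ * γ, δ⁻¹ * γ', by simpa using hne, by simp [hψ, hψinv, hγ, hδ],
      by simp [hψ, hψinv, hγ', hδ], hadj _ _ h2 h1, hadj _ _ h2 h3, hadj' _ _ _ h1 h3⟩
  · exact ⟨γ⁻¹ * δ, γ⁻¹ * δ', by simpa using hne, by simp [hψ, hψinv, hγ, hδ],
      by simp [hψ, hψinv, hγ, hδ'], hadj _ _ h1 h2, hadj _ _ h1 h4, hadj' _ _ _ h2 h4⟩

end Tiling

section PlaneGroup

/-- The group p2: `⟨ε, p, q⟩` stands for the map `x ↦ ε x + (p, q)`. -/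
@[ext]
structure P2 where
  /-- The linear part. -/
  ε : ℤˣ
  /-- The first coordinate of the translation part. -/
  p : ℤ
  /-- The second coordinate of the translation part. -/
  q : ℤ

namespace P2

instance : Mul P2 := ⟨fun a b => ⟨a.ε * b.ε, a.ε * b.p + a.p, a.ε * b.q + a.q⟩⟩

instance : One P2 := ⟨⟨1, 0, 0⟩⟩

instance : Inv P2 := ⟨fun a => ⟨a.ε, -(a.ε * a.p), -(a.ε * a.q)⟩⟩

theorem mul_def (a b : P2) : a * b = ⟨a.ε * b.ε, a.ε * b.p + a.p, a.ε * b.q + a.q⟩ := rfl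

theorem one_def : (1 : P2) = ⟨1, 0, 0⟩ := rfl

theorem inv_def (a : P2) : a⁻¹ = ⟨a.ε, -(a.ε * a.p), -(a.ε * a.q)⟩ := rfl

instance : Group P2 :=
  Group.ofLeftAxioms
    (fun a b c => by ext <;> simp only [mul_def, mul_assoc, Units.val_mul] <;> ring)
    (fun a => by ext <;> simp [mul_def, one_def])
    (fun a => by ext <;> simp [mul_def, one_def, inv_def, Int.units_mul_self])

instance : MulAction P2 Pt where
  smul a x := ((a.ε : ℤ) : ℝ) • x + ![(a.p : ℝ), (a.q : ℝ)]
  one_smul x := by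
    change (((1 : ℤˣ) : ℤ) : ℝ) • x + ![((0 : ℤ) : ℝ), ((0 : ℤ) : ℝ)] = x
    ext i
    fin_cases i <;> simp
  mul_smul a b x := by
    change (((a.ε * b.ε : ℤˣ) : ℤ) : ℝ) • x
        + ![((a.ε * b.p + a.p : ℤ) : ℝ), ((a.ε * b.q + a.q : ℤ) : ℝ)]
      = ((a.ε : ℤ) : ℝ) • (((b.ε : ℤ) : ℝ) • x + ![(b.p : ℝ), (b.q : ℝ)])
        + ![(a.p : ℝ), (a.q : ℝ)]
    ext i
    fin_cases i <;> simp [Matrix.vecHead, Matrix.vecTail] <;> ring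

theorem smul_def (a : P2) (x : Pt) : a • x = ((a.ε : ℤ) : ℝ) • x + ![(a.p : ℝ), (a.q : ℝ)] := rfl

theorem smul_zero_eq (a : P2) : a • (0 : Pt) = ![(a.p : ℝ), (a.q : ℝ)] := by simp [smul_def]

instance : IsIsometricSMul P2 Pt where
  isometry_smul a := Isometry.of_dist_eq fun x y => by
    rw [smul_def, smul_def, dist_add_right, dist_smul₀]
    rcases Int.units_eq_one_or a.ε with h | h <;> simp [h]

theorem isP2_smul (a : P2) : IsP2 (a • · : Pt → Pt) :=
  ⟨((a.ε : ℤ) : ℝ), a.p, a.q, by rcases Int.units_eq_one_or a.ε with h | h <;> simp [h], rfl⟩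

theorem exists_eq_smul_of_isP2 {f : Pt → Pt} (hf : IsP2 f) : ∃ a : P2, f = (a • ·) := by
  obtain ⟨ε, p, q, rfl | rfl, rfl⟩ := hf
  · exact ⟨⟨1, p, q⟩, by ext x; simp [smul_def]⟩
  · exact ⟨⟨-1, p, q⟩, by ext x; simp [smul_def]⟩

theorem smul_left_injective : Function.Injective fun (a : P2) (x : Pt) => a • x := by
  intro a b hab
  have h0 := congrFun hab 0
  have h1 := congrFun (congrFun hab 1) 0
  simp only [smul_zero_eq] at h0
  have hp := congrFun h0 0
  have hq := congrFun h0 1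
  simp only [Matrix.cons_val_zero, Matrix.cons_val_one, Int.cast_inj] at hp hq
  simp [smul_def, hp] at h1
  ext
  · exact_mod_cast h1
  · exact hp
  · exact hq

theorem finite_norm_smul_zero_le (R : ℝ) : {a : P2 | ‖a • (0 : Pt)‖ ≤ R}.Finite := by
  let f : P2 → ℤˣ × ℤ × ℤ := fun a => (a.ε, a.p, a.q)
  have hf : Function.Injective f := fun a b h => by
    simp only [f, Prod.mk.injEq] at h
    exact P2.ext h.1 h.2.1 h.2.2
  refine ((finite_univ.prod ((finite_Icc (-⌊R⌋) ⌊R⌋).prod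
    (finite_Icc (-⌊R⌋) ⌊R⌋))).preimage hf.injOn).subset fun a ha => ?_
  rw [mem_ofPred_eq, smul_zero_eq] at ha
  have hp : |(a.p : ℝ)| ≤ R := (norm_le_pi_norm ![(a.p : ℝ), (a.q : ℝ)] 0).trans ha
  have hq : |(a.q : ℝ)| ≤ R := (norm_le_pi_norm ![(a.p : ℝ), (a.q : ℝ)] 1).trans ha
  have key : ∀ n : ℤ, |(n : ℝ)| ≤ R → n ∈ Icc (-⌊R⌋) ⌊R⌋ := fun n hn => by
    rw [mem_Icc, ← abs_le, Int.le_floor]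
    exact_mod_cast hn
  exact ⟨mem_univ _, key _ hp, key _ hq⟩

/-- The homomorphism `P2 → ZMod 2` sending `⟨1, p, q⟩` to `β p + γ q` and `⟨-1, 0, 0⟩` to `α`. -/
def parity (α β γ : ZMod 2) (a : P2) : ZMod 2 :=
  (if a.ε = 1 then 0 else α) + β * a.p + γ * a.q

theorem parity_mul (α β γ : ZMod 2) (a b : P2) :
    parity α β γ (a * b) = parity α β γ a + parity α β γ b := by
  have hneg : ∀ z : ZMod 2, -z = z := by decide
  have hα : α + α = 0 := by revert α; decide
  have hne : (-1 : ℤˣ) ≠ 1 := by decide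
  rcases Int.units_eq_one_or a.ε with ha | ha <;> rcases Int.units_eq_one_or b.ε with hb | hb <;>
    simp only [parity, mul_def, ha, hb, Units.val_one, Units.val_neg, Int.cast_add, Int.cast_mul,
      Int.cast_one, Int.cast_neg, hneg, one_mul, mul_one, neg_mul_neg, if_true, if_neg hne]
  · ring
  · ring
  · ring
  · linear_combination -hα

theorem exists_parity_eq_zero (a b : P2) (ha : a.ε = -1) (hb : b.ε = -1) :
    ∃ α β γ, parity α β γ a = 0 ∧ parity α β γ b = 0 ∧ ∃ g, parity α β γ g = 1 := by
  have hne : (-1 : ℤˣ) ≠ 1 := by decide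
  have key : ∀ p q p' q' : ZMod 2, ∃ α β γ : ZMod 2, α + β * p + γ * q = 0 ∧
      α + β * p' + γ * q' = 0 ∧ (β = 1 ∨ γ = 1) := by decide
  obtain ⟨α, β, γ, h1, h2, h3⟩ := key a.p a.q b.p b.q
  refine ⟨α, β, γ, by rwa [parity, ha, if_neg hne], by rwa [parity, hb, if_neg hne], ?_⟩
  rcases h3 with rfl | rfl
  · exact ⟨⟨1, 1, 0⟩, by simp [parity]⟩
  · exact ⟨⟨1, 0, 1⟩, by simp [parity]⟩

theorem exists_six_neighbors {K : Set Pt} (hK : IsCompact K)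
    (hcover : ⋃ γ : P2, γ • K = univ) :
    ∃ t : Finset P2, t.card = 6 ∧ ∀ a ∈ t, a ≠ 1 ∧ (K ∩ a • K).Nonempty := by
  classical
  have hrank : 1 < Module.rank ℝ Pt := by simp [Pt]
  have hne : (-1 : ℤˣ) ≠ 1 := by decide
  obtain ⟨a, b, hab, ha, hb, hKa, hKb, hKab⟩ := exists_triangle hrank finite_norm_smul_zero_le hK
    hcover (parity_mul 1 0 0) (g := ⟨-1, 0, 0⟩) (by simp [parity, hne])
  have hrot : ∀ c : P2, parity 1 0 0 c = 1 → c.ε = -1 := fun c hc =>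
    (Int.units_eq_one_or c.ε).resolve_left fun h => by simp [parity, h] at hc
  replace ha := hrot a ha
  replace hb := hrot b hb
  obtain ⟨α, β, γ, hψa, hψb, g, hψg⟩ := exists_parity_eq_zero a b ha hb
  obtain ⟨c, d, hcd, hψc, hψd, hKc, hKd, -⟩ := exists_triangle hrank finite_norm_smul_zero_le hK
    hcover (parity_mul α β γ) hψg
  have hinv : ∀ e : P2, e.ε = -1 → e⁻¹ = e := fun e he => by
    ext <;> simp [inv_def, he]
  have hψab : parity α β γ (a * b) = 0 := by rw [parity_mul, hψa, hψb, add_zero]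
  have hψba : parity α β γ (b * a) = 0 := by rw [parity_mul, hψa, hψb, add_zero]
  have hψ1 : parity α β γ 1 = 0 := by simp [parity, one_def]
  have habε : (a * b).ε = 1 := by simp [mul_def, ha, hb]
  have hbaε : (b * a).ε = 1 := by simp [mul_def, ha, hb]
  have hab1 : a * b ≠ 1 := fun h => hab (by rw [← hinv a ha, inv_eq_of_mul_eq_one_right h])
  have hba1 : b * a ≠ 1 := fun h => hab (by rw [← hinv b hb, inv_eq_of_mul_eq_one_right h])
  have habba : a * b ≠ b * a := fun h => hab (by
    simp only [mul_def, ha, hb, P2.mk.injEq, Units.val_neg, Units.val_one] at h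
    ext
    · rw [ha, hb]
    · omega
    · omega)
  have hKab' : (K ∩ (a * b) • K).Nonempty := by
    have h := hKab.smul_set (a := a⁻¹)
    rwa [smul_set_inter, inv_smul_smul, hinv a ha, smul_smul] at h
  have hKba' : (K ∩ (b * a) • K).Nonempty := by
    have h := hKab.smul_set (a := b⁻¹)
    rwa [inter_comm, smul_set_inter, inv_smul_smul, hinv b hb, smul_smul] at h
  have hεne : ∀ {x y : P2}, x.ε = -1 → y.ε = 1 → x ≠ y := fun hx hy h => hne (by rw [← hx, h, hy])
  have hψne : ∀ {x y : P2}, parity α β γ x = 0 → parity α β γ y = 1 → x ≠ y :=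
    fun hx hy h => zero_ne_one (α := ZMod 2) (by rw [← hx, h, hy])
  refine ⟨{a, b, a * b, b * a, c, d}, ?_, ?_⟩
  · rw [Finset.card_insert_of_notMem, Finset.card_insert_of_notMem, Finset.card_insert_of_notMem,
      Finset.card_insert_of_notMem, Finset.card_pair hcd]
    all_goals simp only [Finset.mem_insert, Finset.mem_singleton, not_or]
    · exact ⟨hψne hψba hψc, hψne hψba hψd⟩
    · exact ⟨habba, hψne hψab hψc, hψne hψab hψd⟩
    · exact ⟨hεne hb habε, hεne hb hbaε, hψne hψb hψc, hψne hψb hψd⟩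
    · exact ⟨hab, hεne ha habε, hεne ha hbaε, hψne hψa hψc, hψne hψa hψd⟩
  · simp only [Finset.mem_insert, Finset.mem_singleton, forall_eq_or_imp, forall_eq]
    exact ⟨⟨hεne ha rfl, hKa⟩, ⟨hεne hb rfl, hKb⟩, ⟨hab1, hKab'⟩, ⟨hba1, hKba'⟩,
      ⟨(hψne hψ1 hψc).symm, hKc⟩, ⟨(hψne hψ1 hψd).symm, hKd⟩⟩

end P2

end PlaneGroup

theorem stmt_7 (K : Set Pt) (hKc : IsCompact K) (hK : K = closure (interior K))
    (hKi : (interior K).Nonempty)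
    (hcover : (⋃ γ ∈ {γ : Pt → Pt | IsP2 γ}, γ '' K) = Set.univ)
    (hdisj : ∀ γ γ' : Pt → Pt, IsP2 γ → IsP2 γ' → γ ≠ γ' →
      interior (γ '' K) ∩ interior (γ' '' K) = ∅) :
    6 ≤ Cardinal.mk ↥{γ : Pt → Pt | IsP2 γ ∧ γ ≠ id ∧ (K ∩ γ '' K).Nonempty} := by
  have hcover' : ⋃ γ : P2, γ • K = univ := by
    refine eq_univ_of_forall fun x => ?_
    obtain ⟨f, hf, hx⟩ := mem_iUnion₂.1 (hcover.symm ▸ mem_univ x)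
    obtain ⟨a, rfl⟩ := P2.exists_eq_smul_of_isP2 hf
    exact mem_iUnion.2 ⟨a, hx⟩
  obtain ⟨t, ht, htK⟩ := P2.exists_six_neighbors hKc hcover'
  have hmem : ∀ a : t, (fun x : Pt => a.1 • x) ∈
      {γ : Pt → Pt | IsP2 γ ∧ γ ≠ id ∧ (K ∩ γ '' K).Nonempty} := fun a =>
    ⟨P2.isP2_smul a, fun h => (htK a a.2).1 (P2.smul_left_injective (h.trans (by
      ext x
      simp))), (htK a a.2).2⟩
  have hle := Cardinal.mk_le_of_injective (f := fun a : t => (⟨_, hmem a⟩ :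
      ↥{γ : Pt → Pt | IsP2 γ ∧ γ ≠ id ∧ (K ∩ γ '' K).Nonempty}))
    fun a b h => Subtype.ext (P2.smul_left_injective (congrArg Subtype.val h))
  rw [Cardinal.mk_coe_finset, ht] at hle
  exact_mod_cast hle
end
end

section
/- Let A, B be integers with 0 < A ≤ B, B ≥ 2 and 2A < B + 3, let M be the 2×2 real matrix with rows (0, −B) and (1, −A), and let T be the unique nonempty compact subset of ℝ² satisfying M·T + ((B−1)/2, 0) = (⋃_{i=0}^{B−2} (T + (i,0))) ∪ (−T). Then every γ in the p2 group Γ with γ ≠ id and T ∩ γ(T) ≠ ∅ is one of the following ten isometries: the translations x ↦ x + w with w ∈ {(A−1,1), (1,0), (−1,0), (1−A,−1)}, or the point reflections x ↦ −x + w with w ∈ {(0,0), (A,1), (A−1,1), (1,0), (−1,0), (1−A,−1)}. Moreover, the neighbor set S = {γ ∈ Γ : γ ≠ id, T ∩ γ(T) ≠ ∅} has at least 6 elements. -/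
open Set Pointwise

noncomputable section

/-- The maps `x ↦ e x + (d, 0)` occurring in `CrysEq`. -/
def Digit (B e d : ℤ) : Prop := (e = 1 ∧ 0 ≤ d ∧ d ≤ B - 2) ∨ (e = -1 ∧ d = 0)

/-- `T` meets its image under `x ↦ ε x + (p, q)`. -/
def Meets (T : Set Pt) (ε p q : ℤ) : Prop :=
  ∃ x ∈ T, ∃ y ∈ T, x 0 = ε * y 0 + p ∧ x 1 = ε * y 1 + q

/-- The edges of the neighbor graph: subdividing `T` and its image under `x ↦ ε x + (p, q)`
yields a pair of pieces in relative position `x ↦ ε' x + (p', q')`. -/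
def Step (A B ε p q ε' p' q' : ℤ) : Prop :=
  ∃ e₁ d₁ e₂ d₂ k, Digit B e₁ d₁ ∧ Digit B e₂ d₂ ∧ (ε = 1 ∧ k = 0 ∨ ε = -1 ∧ k = B - 1) ∧
    ε' = e₁ * ε * e₂ ∧ p' = e₁ * (ε * d₂ - d₁ - B * q + k) ∧ q' = e₁ * (p - A * q)

theorem CrysEq.exists_digit {A B : ℤ} {T : Set Pt} (h : CrysEq A B T) {x : Pt} (hx : x ∈ T) :
    ∃ y ∈ T, ∃ e d : ℤ, Digit B e d ∧ -B * x 1 + ((B : ℝ) - 1) / 2 = e * y 0 + d ∧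
      x 0 - A * x 1 = e * y 1 := by
  have hm := mem_image_of_mem
    (fun x => (!![0, -(B:ℝ); 1, -(A:ℝ)]).mulVec x + ![((B:ℝ)-1)/2, 0]) hx
  rw [h] at hm
  rcases hm with hm | hm
  · simp only [mem_iUnion, Finset.mem_Icc] at hm
    obtain ⟨i, hi, y, hy, he⟩ := hm
    have h0 := congrFun he 0
    have h1 := congrFun he 1
    simp [dotProduct] at h0 h1
    exact ⟨y, hy, 1, i, Or.inl ⟨rfl, hi⟩, by push_cast; linarith, by push_cast; linarith⟩
  · rw [Set.mem_neg] at hm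
    refine ⟨_, hm, -1, 0, Or.inr ⟨rfl, rfl⟩, ?_, ?_⟩
    · simp [dotProduct]
    · simp [dotProduct]; ring

theorem CrysEq.exists_of_digit {A B : ℤ} {T : Set Pt} (h : CrysEq A B T) {y : Pt} (hy : y ∈ T)
    {e d : ℤ} (hd : Digit B e d) :
    ∃ x ∈ T, -B * x 1 + ((B : ℝ) - 1) / 2 = e * y 0 + d ∧ x 0 - A * x 1 = e * y 1 := by
  have hm : (fun j : Fin 2 => e * y j + ![(d : ℝ), 0] j) ∈
      (fun x => (!![0, -(B:ℝ); 1, -(A:ℝ)]).mulVec x + ![((B:ℝ)-1)/2, 0]) '' T := by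
    rw [h]
    rcases hd with ⟨rfl, h0, h1⟩ | ⟨rfl, rfl⟩
    · left
      simp only [mem_iUnion, Finset.mem_Icc]
      exact ⟨d, ⟨h0, h1⟩, y, hy, by ext j; simp⟩
    · right
      rw [Set.mem_neg]
      convert hy using 1
      ext j
      fin_cases j <;> simp
  obtain ⟨x, hx, he⟩ := hm
  have h0 := congrFun he 0
  have h1 := congrFun he 1
  simp [dotProduct] at h0 h1
  exact ⟨x, hx, by linarith, by linarith⟩

theorem Meets.exists_step {A B : ℤ} {T : Set Pt} (h : CrysEq A B T) {ε p q : ℤ}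
    (hε : ε = 1 ∨ ε = -1) (hm : Meets T ε p q) :
    ∃ ε' p' q', (ε' = 1 ∨ ε' = -1) ∧ Step A B ε p q ε' p' q' ∧ Meets T ε' p' q' := by
  obtain ⟨x, hx, y, hy, h0, h1⟩ := hm
  obtain ⟨x', hx', e₁, d₁, hd₁, ha, hb⟩ := h.exists_digit hx
  obtain ⟨y', hy', e₂, d₂, hd₂, hc, hd⟩ := h.exists_digit hy
  have he₁ : e₁ = 1 ∨ e₁ = -1 := hd₁.imp And.left And.left
  have he₂ : e₂ = 1 ∨ e₂ = -1 := hd₂.imp And.left And.left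
  obtain ⟨k, hk⟩ : ∃ k : ℤ, ε = 1 ∧ k = 0 ∨ ε = -1 ∧ k = B - 1 := by
    rcases hε with rfl | rfl
    exacts [⟨0, by simp⟩, ⟨B - 1, by simp⟩]
  refine ⟨_, _, _, ?_, ⟨e₁, d₁, e₂, d₂, k, hd₁, hd₂, hk, rfl, rfl, rfl⟩, x', hx', y', hy', ?_⟩
  · rcases hε with rfl | rfl <;> rcases he₁ with rfl | rfl <;> rcases he₂ with rfl | rfl <;> simp
  · rw [h0, h1] at hb
    rw [h1] at ha
    rcases hk with ⟨rfl, rfl⟩ | ⟨rfl, rfl⟩ <;> rcases he₁ with rfl | rfl <;>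
      rcases he₂ with rfl | rfl <;> push_cast at * <;> constructor <;> linarith

theorem abs_le_one_of_bounded_walk {A B : ℤ} (hA : 0 < A) (hAB : A ≤ B) (hB : 2 ≤ B)
    (h2A : 2 * A < B + 3) {N : ℤ → ℤ → Prop} (hneg : ∀ p q, N p q → N (-p) (-q))
    (hstep : ∀ p q, N p q → ∃ j, |j| ≤ B - 1 ∧ N (-B * q + j) (p - A * q))
    {K : ℤ} (hK : ∀ p q, N p q → |q| ≤ K) {p q : ℤ} (hN : N p q) : |q| ≤ 1 := by
  obtain ⟨Q, ⟨p₀, q₀, hN₀, hQ⟩, hmax⟩ := Int.exists_greatest_of_bdd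
    (P := fun n => ∃ p q, N p q ∧ |q| = n) ⟨K, by rintro _ ⟨p, q, h, rfl⟩; exact hK p q h⟩
    ⟨_, p, q, hN, rfl⟩
  replace hmax : ∀ p q, N p q → -Q ≤ q ∧ q ≤ Q := fun p q h =>
    abs_le.1 (hmax _ ⟨p, q, h, rfl⟩)
  suffices hQ1 : Q ≤ 1 from (abs_le.2 (hmax _ _ hN)).trans hQ1
  obtain ⟨p₁, hN₁⟩ : ∃ p₁, N p₁ Q := by
    rcases abs_choice q₀ with h | h
    · exact ⟨p₀, by rw [← hQ, h]; exact hN₀⟩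
    · exact ⟨-p₀, by rw [← hQ, h]; exact hneg _ _ hN₀⟩
  clear hQ hN₀
  obtain ⟨j₀, hj₀, hN₂⟩ := hstep _ _ hN₁
  obtain ⟨j₁, hj₁, hN₃⟩ := hstep _ _ hN₂
  obtain ⟨j₂, hj₂, hN₄⟩ := hstep _ _ hN₃
  obtain ⟨j₃, hj₃, hN₅⟩ := hstep _ _ hN₄
  obtain ⟨j₄, hj₄, hN₆⟩ := hstep _ _ hN₅
  have b₂ := hmax _ _ hN₂
  have b₃ := hmax _ _ hN₃
  have b₄ := hmax _ _ hN₄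
  have b₅ := hmax _ _ hN₅
  have b₆ := hmax _ _ hN₆
  rw [abs_le] at hj₀ hj₁ hj₂ hj₃ hj₄
  by_contra! hlt
  by_cases h22 : A = 2 ∧ B = 2
  · obtain ⟨rfl, rfl⟩ := h22
    omega
  by_cases h34 : A = 3 ∧ B = 4
  · obtain ⟨rfl, rfl⟩ := h34
    omega
  set s := -(p₁ - A * Q) with hs
  set t := -B * Q + j₀ - A * (p₁ - A * Q) with ht
  have e₁ : A * s ≥ B * (Q - 1) + 1 + t := by
    have : A * s = t + B * Q - j₀ := by rw [hs, ht]; ring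
    linarith
  have e₂ : A * t ≥ B * s - B + 1 - Q := by
    have := b₄.2
    have h4 : -B * (p₁ - A * Q) + j₁ - A * t = B * s + j₁ - A * t := by rw [hs]; ring
    linarith
  have hsQ : s ≤ Q := by linarith
  have e₃ : (A * A - B) * s ≥ (A * B - 1) * (Q - 1) + A - B := by
    have h₁ := mul_le_mul_of_nonneg_left e₁ hA.le
    linarith
  have hs0 : 0 < s := by
    have h₁ : 0 < (B - 1) * (Q - 1) := mul_pos (by linarith) (by linarith)
    have : 0 < A * s := by linarith [b₃.1]
    exact pos_of_mul_pos_right this hA.le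
  have hA1 : (A - 1) * (B + 1) ≥ 0 := mul_nonneg (by linarith) (by linarith)
  have hRHS : (A * B - 1) * (Q - 1) + A - B ≥ (A - 1) * (B + 1) := by
    have h₁ : 0 ≤ (A * B - 1) * (Q - 2) := mul_nonneg (by nlinarith) (by linarith)
    linarith
  rcases lt_trichotomy (A * A) B with h | h | h
  · have := mul_pos (sub_pos.2 h) hs0
    linarith
  · have h₂ : 2 ≤ A := by
      by_contra! h₃
      obtain rfl : A = 1 := by omega
      omega
    rw [h, sub_self, zero_mul] at e₃
    have : 0 < (A - 1) * (B + 1) := mul_pos (by linarith) (by linarith)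
    linarith
  · have e₄ : (A * A - B) * Q ≥ (A * B - 1) * (Q - 1) + A - B :=
      e₃.trans (mul_le_mul_of_nonneg_left hsQ (by linarith))
    have h₁ : 0 ≤ A * (B - A) := mul_nonneg hA.le (by linarith)
    have h₁' : 0 ≤ (A * (B - A) + B - 1) * (Q - 2) := mul_nonneg (by linarith) (by linarith)
    have e₅ : A * A - A ≥ A * B - 1 - A * A + B := by linarith
    have h₂ : A * (B + 2 - 2 * A) ≥ 0 := mul_nonneg hA.le (by linarith)
    have h₃ : B - 1 ≤ A := by linarith
    have : B ≤ 4 := by linarith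
    have : A ≤ 3 := by linarith
    interval_cases B <;> interval_cases A <;> omega

theorem eq_of_bounded_walk {A B : ℤ} (hA : 0 < A) (hAB : A ≤ B) (hB : 2 ≤ B)
    (h2A : 2 * A < B + 3) {N : ℤ → ℤ → Prop} (hneg : ∀ p q, N p q → N (-p) (-q))
    (hstep : ∀ p q, N p q → ∃ j, |j| ≤ B - 1 ∧ N (-B * q + j) (p - A * q))
    {K : ℤ} (hK : ∀ p q, N p q → |q| ≤ K) {p q : ℤ} (hN : N p q) :
    (q = 0 ∧ -1 ≤ p ∧ p ≤ 1) ∨ (q = 1 ∧ A - 1 ≤ p ∧ p ≤ A) ∨ (q = -1 ∧ -A ≤ p ∧ p ≤ 1 - A) := by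
  have key : ∀ p q, N p q → -1 ≤ q ∧ q ≤ 1 := fun p q h =>
    abs_le.1 (abs_le_one_of_bounded_walk hA hAB hB h2A hneg hstep hK h)
  obtain ⟨j₀, hj₀, hN₁⟩ := hstep _ _ hN
  obtain ⟨j₁, hj₁, hN₂⟩ := hstep _ _ hN₁
  have b₀ := key _ _ hN
  have b₁ := key _ _ hN₁
  have b₂ := key _ _ hN₂
  rw [abs_le] at hj₀ hj₁
  obtain ⟨b, hb⟩ : ∃ b, b = p - A * q := ⟨_, rfl⟩
  rw [← hb] at b₁ b₂
  obtain hq | hq | hq : q = -1 ∨ q = 0 ∨ q = 1 := by omega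
  all_goals
    obtain hb' | hb' | hb' : b = -1 ∨ b = 0 ∨ b = 1 := by omega
    all_goals
      subst hq hb'
      omega

theorem Step.exists_abs_le {A B : ℤ} (hB : 2 ≤ B) {ε p q ε' p' q' : ℤ}
    (h : Step A B ε p q ε' p' q') : ∃ j, |j| ≤ B - 1 ∧
      (p' = -B * q + j ∧ q' = p - A * q ∨ -p' = -B * q + j ∧ -q' = p - A * q) := by
  obtain ⟨e₁, d₁, e₂, d₂, k, hd₁, hd₂, hk, -, rfl, rfl⟩ := h
  refine ⟨ε * d₂ - d₁ + k, ?_, ?_⟩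
  · rw [abs_le]
    unfold Digit at hd₁ hd₂
    rcases hk with ⟨rfl, rfl⟩ | ⟨rfl, rfl⟩ <;> constructor <;> omega
  · rcases hd₁ with ⟨rfl, -⟩ | ⟨rfl, -⟩
    · left; constructor <;> ring
    · right; constructor <;> ring

theorem Meets.abs_le_of_norm_le {T : Set Pt} {C : ℝ} (hC : ∀ x ∈ T, ‖x‖ ≤ C) {ε p q : ℤ}
    (hε : ε = 1 ∨ ε = -1) (h : Meets T ε p q) : |q| ≤ ⌈2 * C⌉ := by
  obtain ⟨x, hx, y, hy, -, h1⟩ := h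
  have hx1 := abs_le.1 ((norm_le_pi_norm x 1).trans (hC x hx))
  have hy1 := abs_le.1 ((norm_le_pi_norm y 1).trans (hC y hy))
  have : |(q : ℝ)| ≤ 2 * C := by
    rw [abs_le]
    rcases hε with rfl | rfl <;> push_cast at h1 <;> constructor <;> linarith
  exact_mod_cast this.trans (Int.le_ceil _)

theorem Meets.translation_mem {A B : ℤ} (hA : 0 < A) (hAB : A ≤ B) (hB : 2 ≤ B)
    (h2A : 2 * A < B + 3) {T : Set Pt} (hTc : IsCompact T) (hT : CrysEq A B T) {ε p q : ℤ}
    (hε : ε = 1 ∨ ε = -1) (h : Meets T ε p q) :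
    (q = 0 ∧ -1 ≤ p ∧ p ≤ 1) ∨ (q = 1 ∧ A - 1 ≤ p ∧ p ≤ A) ∨ (q = -1 ∧ -A ≤ p ∧ p ≤ 1 - A) := by
  obtain ⟨C, hC⟩ := hTc.isBounded.exists_norm_le
  refine eq_of_bounded_walk hA hAB hB h2A (N := fun p q => ∃ ε : ℤ, (ε = 1 ∨ ε = -1) ∧
    (Meets T ε p q ∨ Meets T ε (-p) (-q))) (K := ⌈2 * C⌉) ?_ ?_ ?_ ⟨ε, hε, Or.inl h⟩
  · rintro p q ⟨ε, hε, h⟩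
    exact ⟨ε, hε, by simpa using h.symm⟩
  · rintro p q ⟨ε, hε, h | h⟩
    · obtain ⟨ε', p', q', hε', hs, hm⟩ := h.exists_step hT hε
      obtain ⟨j, hj, ⟨rfl, rfl⟩ | ⟨h0, h1⟩⟩ := hs.exists_abs_le hB
      · exact ⟨j, hj, ε', hε', Or.inl hm⟩
      · exact ⟨j, hj, ε', hε', Or.inr (by rwa [← h0, ← h1, neg_neg, neg_neg])⟩
    · obtain ⟨ε', p', q', hε', hs, hm⟩ := h.exists_step hT hε
      obtain ⟨j, hj, ⟨h0, h1⟩ | ⟨h0, h1⟩⟩ := hs.exists_abs_le hB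
      · refine ⟨-j, by rwa [abs_neg], ε', hε', Or.inr ?_⟩
        convert hm using 1
        · rw [h0]; ring
        · rw [h1]; ring
      · refine ⟨-j, by rwa [abs_neg], ε', hε', Or.inl ?_⟩
        convert hm using 1 <;> linarith
  · rintro p q ⟨ε, hε, h | h⟩
    · exact h.abs_le_of_norm_le hC hε
    · simpa using h.abs_le_of_norm_le hC hε

theorem Meets.mem_neighbors {A B : ℤ} (hA : 0 < A) (hAB : A ≤ B) (hB : 2 ≤ B)
    (h2A : 2 * A < B + 3) {T : Set Pt} (hTc : IsCompact T) (hT : CrysEq A B T) {ε p q : ℤ}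
    (hε : ε = 1 ∨ ε = -1) (hne : ¬(ε = 1 ∧ p = 0 ∧ q = 0)) (h : Meets T ε p q) :
    (ε = 1 ∧ (p, q) ∈ ({(A-1,1), (1,0), (-1,0), (1-A,-1)} : Set (ℤ × ℤ))) ∨
      (ε = -1 ∧
        (p, q) ∈ ({(0,0), (A,1), (A-1,1), (1,0), (-1,0), (1-A,-1)} : Set (ℤ × ℤ))) := by
  have hpq := h.translation_mem hA hAB hB h2A hTc hT hε
  obtain ⟨ε', p', q', hε', ⟨e₁, d₁, e₂, d₂, k, hd₁, hd₂, hk, -, rfl, rfl⟩, hm⟩ :=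
    h.exists_step hT hε
  have hpq' := hm.translation_mem hA hAB hB h2A hTc hT hε'
  have excluded : ¬(p = A * q ∧ (q = 1 ∧ ε = 1 ∨ q = -1)) := by
    rintro ⟨rfl, hq⟩
    have h0 : e₁ * (A * q - A * q) = 0 := by ring
    rw [h0] at hpq'
    unfold Digit at hd₁ hd₂
    rcases hq with ⟨rfl, rfl⟩ | rfl <;> rcases hk with ⟨hk, rfl⟩ | ⟨hk, rfl⟩ <;>
      rcases hd₁ with ⟨rfl, _⟩ | ⟨rfl, _⟩ <;> subst_vars <;> omega
  simp only [mem_insert_iff, mem_singleton_iff, Prod.mk.injEq]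
  rcases hpq with ⟨rfl, _⟩ | ⟨rfl, _⟩ | ⟨rfl, _⟩ <;> omega

/-- A norm-like function for which the expanding matrix of `CrysEq` is uniformly expanding. -/
theorem exists_expanding {A B : ℤ} (hA : 0 < A) (hAB : A ≤ B) (hB : 2 ≤ B)
    (h2A : 2 * A < B + 3) : ∃ (V : ℝ → ℝ → ℝ) (ρ : ℝ), Continuous (fun v : ℝ × ℝ => V v.1 v.2) ∧
      0 ≤ ρ ∧ ρ < 1 ∧ (∀ a b, V (-a) (-b) = V a b) ∧ (∀ a b, V a b ≤ 0 → a = 0 ∧ b = 0) ∧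
      ∀ a b, V a b ≤ ρ * V (-B * b) (a - A * b) := by
  have hB' : (2 : ℝ) ≤ B := by exact_mod_cast hB
  have hA' : (0 : ℝ) < A := by exact_mod_cast hA
  rcases le_or_gt B (A + 1) with h | h
  · have hd : A * A < 4 * B := by
      have : B ≤ 4 := by linarith
      have : A ≤ 3 := by linarith
      interval_cases B <;> interval_cases A <;> omega
    have hd' : (A : ℝ) * A < 4 * B := by exact_mod_cast hd
    refine ⟨fun a b => B * b ^ 2 + a ^ 2 - A * a * b, 1 / B, by fun_prop, by positivity, ?_, ?_,
      ?_, ?_⟩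
    · rw [div_lt_one (by linarith)]; linarith
    · intro a b; ring
    · intro a b hV
      have hb : b = 0 := by
        by_contra hb
        have : 0 < b ^ 2 := by positivity
        nlinarith [sq_nonneg (2 * a - A * b)]
      subst hb
      exact ⟨by nlinarith, rfl⟩
    · intro a b
      apply le_of_eq
      field_simp
      ring
  · have h' : (A : ℝ) + 2 ≤ B := by exact_mod_cast (show A + 2 ≤ B by linarith)
    set s : ℝ := 3 / (2 * B) with hs
    have hs0 : 0 < s := by positivity
    refine ⟨fun a b => |b| + s * |a - A * b|, max (2 / 3) ((A + 3 / 2) / B), by fun_prop,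
      by positivity, ?_, ?_, ?_, ?_⟩
    · exact max_lt (by norm_num) ((div_lt_one (by linarith)).2 (by linarith))
    · intro a b
      simp only [abs_neg]
      rw [← abs_neg (a - A * b)]
      ring_nf
    · intro a b hV
      have h1 := abs_nonneg b
      have h2 := mul_nonneg hs0.le (abs_nonneg (a - A * b))
      have hb : b = 0 := abs_eq_zero.1 (by linarith)
      have h3 : |a - A * b| = 0 := by nlinarith [abs_nonneg (a - A * b)]
      rw [abs_eq_zero, hb] at h3
      exact ⟨by linarith, hb⟩
    · intro a b
      obtain ⟨c, hc⟩ : ∃ c, c = a - A * b := ⟨_, rfl⟩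
      simp only [← hc]
      have h1 : B * |b| ≤ A * |c| + |-B * b - A * c| := by
        calc B * |b| = |-(A * c) - (-B * b - A * c)| := by
              rw [← abs_of_pos (show (0 : ℝ) < B by linarith), ← abs_mul,
                abs_of_pos (show (0 : ℝ) < B by linarith)]
              ring_nf
          _ ≤ |-(A * c)| + |-B * b - A * c| := abs_sub _ _
          _ = A * |c| + |-B * b - A * c| := by rw [abs_neg, abs_mul, abs_of_pos hA']
      obtain ⟨u, hu⟩ : ∃ u, u = |-B * b - A * c| := ⟨_, rfl⟩
      rw [← hu] at h1 ⊢
      have hu0 : 0 ≤ u := hu ▸ abs_nonneg _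
      have hc0 := abs_nonneg c
      have e1 : |b| + s * |c| ≤ (A + 3 / 2) / B * |c| + 2 / 3 * (s * u) := by
        rw [hs]
        field_simp
        nlinarith
      rw [mul_add]
      refine e1.trans (add_le_add ?_ ?_)
      · exact mul_le_mul_of_nonneg_right (le_max_right _ _) hc0
      · exact mul_le_mul_of_nonneg_right (le_max_left _ _) (by positivity)

theorem meets_of_walk {A B : ℤ} (hA : 0 < A) (hAB : A ≤ B) (hB : 2 ≤ B)
    (h2A : 2 * A < B + 3) {T : Set Pt} (hTne : T.Nonempty) (hTc : IsCompact T)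
    (hT : CrysEq A B T) {N : Set (ℤ × ℤ × ℤ)} (hNfin : N.Finite)
    (hstep : ∀ g ∈ N, ∃ g' ∈ N, Step A B g.1 g.2.1 g.2.2 g'.1 g'.2.1 g'.2.2)
    {g : ℤ × ℤ × ℤ} (hg : g ∈ N) : Meets T g.1 g.2.1 g.2.2 := by
  obtain ⟨V, ρ, hVc, hρ0, hρ1, hVneg, hV0, hVρ⟩ := exists_expanding hA hAB hB h2A
  let F : ℤ × ℤ × ℤ → Pt × Pt → ℝ := fun g z =>
    V (z.1 0 - g.1 * z.2 0 - g.2.1) (z.1 1 - g.1 * z.2 1 - g.2.2)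
  have hF : ∀ g, Continuous (F g) := fun g =>
    hVc.comp (f := fun z : Pt × Pt =>
      (z.1 0 - g.1 * z.2 0 - g.2.1, z.1 1 - g.1 * z.2 1 - g.2.2)) (by fun_prop)
  obtain ⟨t, ht⟩ := hTne
  obtain ⟨C, hC⟩ : ∃ C, ∀ g ∈ N, F g (t, t) ≤ C := by
    obtain ⟨C, hC⟩ := (hNfin.image (fun g => F g (t, t))).bddAbove
    exact ⟨C, fun g hg => hC (mem_image_of_mem _ hg)⟩
  have key : ∀ n : ℕ, ∀ g ∈ N, ∃ z ∈ T ×ˢ T, F g z ≤ ρ ^ n * C := by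
    intro n
    induction n with
    | zero => exact fun g hg => ⟨(t, t), ⟨ht, ht⟩, by simpa using hC g hg⟩
    | succ n ih =>
      rintro ⟨ε, p, q⟩ hg
      obtain ⟨⟨ε', p', q'⟩, hg', e₁, d₁, e₂, d₂, k, hd₁, hd₂, hk, h1, h2, h3⟩ := hstep _ hg
      obtain ⟨⟨x', y'⟩, ⟨hx', hy'⟩, hF'⟩ := ih _ hg'
      obtain ⟨x, hx, hx0, hx1⟩ := hT.exists_of_digit hx' hd₁
      obtain ⟨y, hy, hy0, hy1⟩ := hT.exists_of_digit hy' hd₂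
      refine ⟨(x, y), ⟨hx, hy⟩, (hVρ _ _).trans ?_⟩
      rw [pow_succ', mul_assoc]
      refine mul_le_mul_of_nonneg_left (le_of_eq_of_le ?_ hF') hρ0
      dsimp only at h1 h2 h3 hk ⊢
      subst h1 h2 h3
      have he₁ : e₁ = 1 ∨ e₁ = -1 := hd₁.imp And.left And.left
      have he₂ : e₂ = 1 ∨ e₂ = -1 := hd₂.imp And.left And.left
      rcases he₁ with rfl | rfl
      · dsimp only [F]
        congr 1
        · rcases hk with ⟨rfl, rfl⟩ | ⟨rfl, rfl⟩ <;> push_cast at * <;> linarith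
        · rcases hk with ⟨rfl, rfl⟩ | ⟨rfl, rfl⟩ <;> push_cast at * <;> linarith
      · dsimp only [F]
        rw [← hVneg]
        congr 1
        · rcases hk with ⟨rfl, rfl⟩ | ⟨rfl, rfl⟩ <;> push_cast at * <;> linarith
        · rcases hk with ⟨rfl, rfl⟩ | ⟨rfl, rfl⟩ <;> push_cast at * <;> linarith
  obtain ⟨⟨x, y⟩, ⟨hx, hy⟩, hmin⟩ :=
    (hTc.prod hTc).exists_isMinOn ⟨(t, t), ht, ht⟩ (hF g).continuousOn
  have hle : F g (x, y) ≤ 0 := by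
    have hlim : Filter.Tendsto (fun n : ℕ => ρ ^ n * C) Filter.atTop (nhds (0 * C)) :=
      (tendsto_pow_atTop_nhds_zero_of_lt_one hρ0 hρ1).mul_const C
    rw [zero_mul] at hlim
    refine ge_of_tendsto' hlim fun n => ?_
    obtain ⟨z, hz, hzn⟩ := key n g hg
    exact (hmin hz).trans hzn
  obtain ⟨h0, h1⟩ := hV0 _ _ hle
  exact ⟨x, hx, y, hy, by linarith, by linarith⟩

theorem meets_iff {T : Set Pt} {ε p q : ℤ} : Meets T ε p q ↔
    (T ∩ (fun x : Pt => (ε : ℝ) • x + ![(p:ℝ), (q:ℝ)]) '' T).Nonempty := by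
  constructor
  · rintro ⟨x, hx, y, hy, h0, h1⟩
    exact ⟨x, hx, y, hy, by ext j; fin_cases j <;> simp [h0, h1]⟩
  · rintro ⟨_, hx, y, hy, rfl⟩
    exact ⟨_, hx, y, hy, by simp, by simp⟩

theorem Meets.translation_neg {T : Set Pt} {p q : ℤ} (h : Meets T 1 p q) :
    Meets T 1 (-p) (-q) := by
  obtain ⟨x, hx, y, hy, h0, h1⟩ := h
  refine ⟨y, hy, x, hx, ?_, ?_⟩ <;> push_cast at * <;> linarith

theorem isometry_injective : Function.Injective
    (fun (g : ℤ × ℤ × ℤ) (x : Pt) => (g.1 : ℝ) • x + ![(g.2.1:ℝ), (g.2.2:ℝ)]) := by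
  rintro ⟨ε, p, q⟩ ⟨ε', p', q'⟩ h
  have h0 := congrFun (congrFun h 0) 0
  have h1 := congrFun (congrFun h 0) 1
  have h2 := congrFun (congrFun h 1) 0
  simp at h0 h1 h2
  subst h0 h1
  simpa using h2

theorem card_le_neighbors {T : Set Pt} (s : Finset (ℤ × ℤ × ℤ))
    (hs : ∀ g ∈ s, (g.1 = 1 ∨ g.1 = -1) ∧ g ≠ (1, 0, 0) ∧ Meets T g.1 g.2.1 g.2.2) :
    (s.card : Cardinal) ≤
      Cardinal.mk ↥{γ : Pt → Pt | IsP2 γ ∧ γ ≠ id ∧ (T ∩ γ '' T).Nonempty} := by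
  rw [← Cardinal.mk_coe_finset]
  refine Cardinal.mk_le_of_injective (f := fun g => ⟨_, ⟨g.1.1, g.1.2.1, g.1.2.2, ?_, rfl⟩, ?_,
    meets_iff.1 (hs g.1 g.2).2.2⟩) ?_
  · exact_mod_cast (hs g.1 g.2).1
  · intro h
    refine (hs g.1 g.2).2.1 (isometry_injective ?_)
    simp only [h]
    ext x j
    fin_cases j <;> simp
  · intro g g' h
    exact Subtype.ext (isometry_injective (congrArg Subtype.val h))

theorem six_le_neighbors_of_two_le {A B : ℤ} (hA : 2 ≤ A) (hAB : A ≤ B)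
    (h2A : 2 * A < B + 3) {T : Set Pt} (hTne : T.Nonempty) (hTc : IsCompact T)
    (hT : CrysEq A B T) :
    6 ≤ Cardinal.mk ↥{γ : Pt → Pt | IsP2 γ ∧ γ ≠ id ∧ (T ∩ γ '' T).Nonempty} := by
  have hB : 2 ≤ B := hA.trans hAB
  let s : Finset (ℤ × ℤ × ℤ) :=
    {(-1, 0, 0), (-1, 1, 0), (-1, A, 1), (-1, A - 1, 1), (1, A - 1, 1)}
  have hs : ∀ g ∈ s, Meets T g.1 g.2.1 g.2.2 := by
    refine fun g hg => meets_of_walk (by linarith) hAB hB h2A hTne hTc hT s.finite_toSet ?_ hg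
    intro g hg
    simp only [s, Finset.coe_insert, Finset.coe_singleton, mem_insert_iff, mem_singleton_iff]
      at hg ⊢
    rcases hg with rfl | rfl | rfl | rfl | rfl
    · exact ⟨(-1, 1, 0), by simp, 1, B - 2, 1, 0, B - 1, by unfold Digit; grind⟩
    · exact ⟨(-1, A - 1, 1), by simp, 1, B - A, 1, 0, B - 1, by unfold Digit; grind⟩
    · exact ⟨(-1, 1, 0), by simp, -1, 0, -1, 0, B - 1, by unfold Digit; grind⟩
    · exact ⟨(1, A - 1, 1), by simp, -1, 0, 1, A - 2, B - 1, by unfold Digit; grind⟩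
    · exact ⟨(-1, A, 1), by simp, -1, 0, 1, B - A, 0, by unfold Digit; grind⟩
  have hcard : (insert (1, 1 - A, -1) s).card = 6 := by
    simp only [s]
    repeat rw [Finset.card_insert_of_notMem (by simp; try omega)]
    simp
  have := card_le_neighbors (T := T) (insert (1, 1 - A, -1) s) ?_
  · rw [hcard] at this
    exact_mod_cast this
  intro g hg
  rw [Finset.mem_insert] at hg
  refine ⟨?_, ?_, ?_⟩
  · simp only [s, Finset.mem_insert, Finset.mem_singleton] at hg
    rcases hg with rfl | rfl | rfl | rfl | rfl | rfl <;> simp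
  · simp only [s, Finset.mem_insert, Finset.mem_singleton] at hg
    rcases hg with rfl | rfl | rfl | rfl | rfl | rfl <;> simp
  · rcases hg with rfl | hg
    · simpa using (hs (1, A - 1, 1) (by simp [s])).translation_neg
    · exact hs g hg

theorem six_le_neighbors_of_eq_one {B : ℤ} (hB : 2 ≤ B) {T : Set Pt} (hTne : T.Nonempty)
    (hTc : IsCompact T) (hT : CrysEq 1 B T) :
    6 ≤ Cardinal.mk ↥{γ : Pt → Pt | IsP2 γ ∧ γ ≠ id ∧ (T ∩ γ '' T).Nonempty} := by
  let s : Finset (ℤ × ℤ × ℤ) := {(-1, 0, 0), (-1, 1, 0), (-1, 1, 1), (-1, 0, 1), (1, 1, 0)}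
  have hs : ∀ g ∈ s, Meets T g.1 g.2.1 g.2.2 := by
    refine fun g hg => meets_of_walk one_pos (by linarith) hB (by linarith) hTne hTc hT
      s.finite_toSet ?_ hg
    intro g hg
    simp only [s, Finset.coe_insert, Finset.coe_singleton, mem_insert_iff, mem_singleton_iff]
      at hg ⊢
    rcases hg with rfl | rfl | rfl | rfl | rfl
    · exact ⟨(-1, 1, 0), by simp, 1, B - 2, 1, 0, B - 1, by unfold Digit; grind⟩
    · exact ⟨(-1, 1, 1), by simp, 1, B - 2, 1, 0, B - 1, by unfold Digit; grind⟩
    · exact ⟨(-1, 1, 0), by simp, -1, 0, -1, 0, B - 1, by unfold Digit; grind⟩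
    · exact ⟨(-1, 1, 1), by simp, -1, 0, -1, 0, B - 1, by unfold Digit; grind⟩
    · exact ⟨(-1, 0, 1), by simp, 1, 0, -1, 0, 0, by unfold Digit; grind⟩
  have := card_le_neighbors (T := T) (insert (1, -1, 0) s) ?_
  · exact_mod_cast this
  intro g hg
  rw [Finset.mem_insert] at hg
  refine ⟨?_, ?_, ?_⟩
  · simp only [s, Finset.mem_insert, Finset.mem_singleton] at hg
    rcases hg with rfl | rfl | rfl | rfl | rfl | rfl <;> simp
  · simp only [s, Finset.mem_insert, Finset.mem_singleton] at hg
    rcases hg with rfl | rfl | rfl | rfl | rfl | rfl <;> simp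
  · rcases hg with rfl | hg
    · simpa using (hs (1, 1, 0) (by simp [s])).translation_neg
    · exact hs g hg

theorem stmt_8 (A B : ℤ) (hA : 0 < A) (hAB : A ≤ B) (hB : 2 ≤ B) (h2A : 2 * A < B + 3)
    (T : Set Pt) (hTne : T.Nonempty) (hTc : IsCompact T) (hT : CrysEq A B T) :
    (∀ (ε : ℝ) (p q : ℤ), (ε = 1 ∨ ε = -1) →
      (fun x : Pt => ε • x + ![(p:ℝ), (q:ℝ)]) ≠ id →
      (T ∩ (fun x : Pt => ε • x + ![(p:ℝ), (q:ℝ)]) '' T).Nonempty →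
      (ε = 1 ∧ (p, q) ∈ ({(A-1,1), (1,0), (-1,0), (1-A,-1)} : Set (ℤ × ℤ))) ∨
      (ε = -1 ∧ (p, q) ∈ ({(0,0), (A,1), (A-1,1), (1,0), (-1,0), (1-A,-1)} : Set (ℤ × ℤ)))) ∧
    6 ≤ Cardinal.mk ↥{γ : Pt → Pt | IsP2 γ ∧ γ ≠ id ∧ (T ∩ γ '' T).Nonempty} := by

  constructor
  · intro ε p q hε hne hmeet
    obtain ⟨n, hn, rfl⟩ : ∃ n : ℤ, (n = 1 ∨ n = -1) ∧ ε = n := by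
      rcases hε with rfl | rfl
      exacts [⟨1, by simp⟩, ⟨-1, by simp⟩]
    have h := (meets_iff.2 hmeet).mem_neighbors hA hAB hB h2A hTc hT hn (by
      rintro ⟨rfl, rfl, rfl⟩
      refine hne ?_
      ext x j
      fin_cases j <;> simp)
    exact h.imp (And.imp_left fun h => by simp [h]) (And.imp_left fun h => by simp [h])
  · rcases (show 1 ≤ A from hA).eq_or_lt with rfl | h
    · exact six_le_neighbors_of_eq_one hB hTne hTc hT
    · exact six_le_neighbors_of_two_le h hAB h2A hTne hTc hT
end
end

section
/- Let A = 2 and let B ≥ 3 be an integer, let M be the 2×2 real matrix with rows (0, −B) and (1, −2), and let T be the unique nonempty compact subset of ℝ² satisfying M·T + ((B−1)/2, 0) = (⋃_{i=0}^{B−2} (T + (i,0))) ∪ (−T). Then for γ in the p2 group Γ with γ ≠ id, one has T ∩ γ(T) ≠ ∅ if and only if γ is one of the following eight isometries: a translation x ↦ x + w with w ∈ {(1,0), (−1,0), (1,1), (−1,−1)}, or a point reflection x ↦ −x + w with w ∈ {(0,0), (1,0), (1,1), (2,1)}. -/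
open Set Pointwise

noncomputable section

/-- The quadratic form that multiplication by `!![0, -B; 1, -2]` scales by the factor `B`. -/
def crysForm (B a b : ℝ) : ℝ := (a - b) ^ 2 + (B - 1) * b ^ 2

/-- The points of `T` and of its image under `x ↦ ε x + (p, q)` meet. -/
def Touch (T : Set Pt) (ε : ℝ) (p q : ℤ) : Prop :=
  ∃ x ∈ T, ∃ y ∈ T, x 0 = ε * y 0 + p ∧ x 1 = ε * y 1 + q

/-- The values of `crysForm` on the differences of points of `T` and of its image under
`x ↦ ε x + (p, q)`. -/
def gapValues (B : ℝ) (T : Set Pt) (ε p q : ℝ) : Set ℝ :=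
  {t | ∃ x ∈ T, ∃ y ∈ T, t = crysForm B (x 0 - ε * y 0 - p) (x 1 - ε * y 1 - q)}

theorem abs_le_one_of_bounded_walk_s10 {B : ℤ} (hB : 3 ≤ B) {N : ℤ → ℤ → Prop}
    (hbdd : ∃ C : ℤ, ∀ p q, N p q → |p| ≤ C ∧ |q| ≤ C)
    (hstep : ∀ p q, N p q → ∃ s k : ℤ, (s = 1 ∨ s = -1) ∧ |k| ≤ B - 1 ∧
      N (s * (B * q) + k) (-s * (p - 2 * q))) {p q : ℤ} (h : N p q) : |q| ≤ 1 := by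
  obtain ⟨C, hC⟩ := hbdd
  obtain ⟨F, ⟨p₁, q₁, h₁, hF⟩, hmax⟩ := Int.exists_greatest_of_bdd
    (P := fun z => ∃ p q, N p q ∧ z = (p - q) ^ 2 + (B - 1) * q ^ 2)
    ⟨(2 * C) ^ 2 + (B - 1) * C ^ 2, by
      rintro z ⟨p, q, h, rfl⟩
      obtain ⟨hp, hq⟩ := hC p q h
      have h1 : |p - q| ≤ 2 * C := (abs_sub p q).trans (by linarith)
      have h2 := sq_le_sq' (neg_le_of_abs_le h1) (le_of_abs_le h1)
      have h3 := sq_le_sq' (neg_le_of_abs_le hq) (le_of_abs_le hq)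
      nlinarith⟩ ⟨_, p, q, h, rfl⟩
  have hle := hmax _ ⟨p, q, h, rfl⟩
  obtain ⟨s, k, hs, hk, h₂⟩ := hstep _ _ h₁
  have hle₂ := hmax _ ⟨_, _, h₂, rfl⟩
  set p₂ := s * (B * q₁) + k with hp₂
  set q₂ := -s * (p₁ - 2 * q₁) with hq₂
  have hs2 : s ^ 2 = 1 := by rcases hs with rfl | rfl <;> rfl
  have hscale : B * F = (p₂ - k - q₂) ^ 2 + (B - 1) * q₂ ^ 2 := by
    rw [hF]
    linear_combination (-(B * q₁ + p₁ - 2 * q₁) ^ 2 - (B - 1) * (p₁ - 2 * q₁) ^ 2) * hs2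
  have hu : (p₂ - q₂) ^ 2 ≤ F := by nlinarith [sq_nonneg q₂]
  have hk2 : k ^ 2 ≤ (B - 1) ^ 2 := sq_le_sq' (neg_le_of_abs_le hk) (le_of_abs_le hk)
  have hcross : -(k * (p₂ - q₂)) ≤ (B - 1) * |p₂ - q₂| :=
    (neg_le_abs _).trans (by rw [abs_mul]; gcongr)
  set u := |p₂ - q₂| with hu_def
  have hu0 : 0 ≤ u := abs_nonneg _
  have hu2 : u ^ 2 ≤ F := by rw [hu_def, sq_abs]; exact hu
  have hFu : F ≤ 2 * u + (B - 1) := by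
    have : (B - 1) * F ≤ (B - 1) * (2 * u + (B - 1)) := by nlinarith
    exact le_of_mul_le_mul_left this (by linarith)
  by_contra! hq
  have hq4 : 4 ≤ q ^ 2 := by
    rw [← sq_abs]; nlinarith
  have hF4 : 4 * (B - 1) ≤ F := by nlinarith [sq_nonneg (p - q)]
  have hu3 : u ≤ 2 := by nlinarith
  nlinarith

theorem bounded_walk_classification {B : ℤ} (hB : 3 ≤ B) {Tr Rf : ℤ → ℤ → Prop}
    (hbdd : ∃ C : ℤ, ∀ p q, Tr p q ∨ Rf p q → |p| ≤ C ∧ |q| ≤ C)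
    (hTr : ∀ p q, Tr p q →
      (∃ k, -(B - 2) ≤ k ∧ k ≤ B - 2 ∧ Tr (-(B * q) + k) (p - 2 * q)) ∨
      (∃ d, 0 ≤ d ∧ d ≤ B - 2 ∧ Rf (-(B * q) - d) (p - 2 * q)) ∨
      (∃ d, 0 ≤ d ∧ d ≤ B - 2 ∧ Rf (B * q - d) (2 * q - p)) ∨
      Tr (B * q) (2 * q - p))
    (hRf : ∀ p q, Rf p q →
      (∃ m, 0 ≤ m ∧ m ≤ 2 * B - 4 ∧ Rf (-(B * q) + (B - 1) - m) (p - 2 * q)) ∨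
      (∃ d, 0 ≤ d ∧ d ≤ B - 2 ∧ Tr (-(B * q) + (B - 1) - d) (p - 2 * q)) ∨
      (∃ d, 0 ≤ d ∧ d ≤ B - 2 ∧ Tr (B * q - (B - 1) + d) (2 * q - p)) ∨
      Rf (B * q - (B - 1)) (2 * q - p)) :
    (∀ p q, Tr p q → ¬(p = 0 ∧ q = 0) →
      (p, q) ∈ ({(1,0), (-1,0), (1,1), (-1,-1)} : Set (ℤ × ℤ))) ∧
    (∀ p q, Rf p q → (p, q) ∈ ({(0,0), (1,0), (1,1), (2,1)} : Set (ℤ × ℤ))) := by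
  have hq : ∀ p q, Tr p q ∨ Rf p q → |q| ≤ 1 := by
    intro p q h
    refine abs_le_one_of_bounded_walk_s10 hB hbdd ?_ h
    rintro p q (h | h)
    · rcases hTr p q h with ⟨k, h1, h2, h⟩ | ⟨d, h1, h2, h⟩ | ⟨d, h1, h2, h⟩ | h
      · exact ⟨-1, k, by simp, abs_le.2 ⟨by linarith, by linarith⟩,
          Or.inl (by convert h using 1 <;> ring)⟩
      · exact ⟨-1, -d, by simp, abs_le.2 ⟨by linarith, by linarith⟩,
          Or.inr (by convert h using 1 <;> ring)⟩
      · exact ⟨1, -d, by simp, abs_le.2 ⟨by linarith, by linarith⟩,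
          Or.inr (by convert h using 1 <;> ring)⟩
      · exact ⟨1, 0, by simp, abs_le.2 ⟨by linarith, by linarith⟩,
          Or.inl (by convert h using 1 <;> ring)⟩
    · rcases hRf p q h with ⟨k, h1, h2, h⟩ | ⟨d, h1, h2, h⟩ | ⟨d, h1, h2, h⟩ | h
      · exact ⟨-1, B - 1 - k, by simp, abs_le.2 ⟨by linarith, by linarith⟩,
          Or.inr (by convert h using 1 <;> ring)⟩
      · exact ⟨-1, B - 1 - d, by simp, abs_le.2 ⟨by linarith, by linarith⟩,
          Or.inl (by convert h using 1 <;> ring)⟩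
      · exact ⟨1, -(B - 1) + d, by simp, abs_le.2 ⟨by linarith, by linarith⟩,
          Or.inl (by convert h using 1 <;> ring)⟩
      · exact ⟨1, -(B - 1), by simp, abs_le.2 ⟨by linarith, by linarith⟩,
          Or.inr (by convert h using 1 <;> ring)⟩
  have hr : ∀ p q, Tr p q ∨ Rf p q → |p - 2 * q| ≤ 1 := by
    rintro p q (h | h)
    · rcases hTr p q h with ⟨k, h1, h2, h⟩ | ⟨d, h1, h2, h⟩ | ⟨d, h1, h2, h⟩ | h
      · exact hq _ _ (Or.inl h)
      · exact hq _ _ (Or.inr h)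
      · rw [abs_sub_comm]; exact hq _ _ (Or.inr h)
      · rw [abs_sub_comm]; exact hq _ _ (Or.inl h)
    · rcases hRf p q h with ⟨k, h1, h2, h⟩ | ⟨d, h1, h2, h⟩ | ⟨d, h1, h2, h⟩ | h
      · exact hq _ _ (Or.inr h)
      · exact hq _ _ (Or.inl h)
      · rw [abs_sub_comm]; exact hq _ _ (Or.inl h)
      · rw [abs_sub_comm]; exact hq _ _ (Or.inr h)
  have hbox : ∀ p q, Tr p q ∨ Rf p q →
      (q = -1 ∨ q = 0 ∨ q = 1) ∧ -1 ≤ p - 2 * q ∧ p - 2 * q ≤ 1 := by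
    intro p q h
    have h1 := abs_le.1 (hq p q h)
    have h2 := abs_le.1 (hr p q h)
    omega
  have hRf31 : ¬ Rf 3 1 := by
    intro h
    rcases hRf _ _ h with ⟨k, h1, h2, h⟩ | ⟨d, h1, h2, h⟩ | ⟨d, h1, h2, h⟩ | h
    · have := hbox _ _ (Or.inr h); omega
    · have := hbox _ _ (Or.inl h); omega
    · have := hbox _ _ (Or.inl h); omega
    · have := hbox _ _ (Or.inr h); omega
  have hRfneg : ∀ p, ¬ Rf p (-1) := by
    intro p h
    have hp := hbox _ _ (Or.inr h)
    rcases hRf _ _ h with ⟨k, h1, h2, h⟩ | ⟨d, h1, h2, h⟩ | ⟨d, h1, h2, h⟩ | h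
    · have := hbox _ _ (Or.inr h)
      refine hRf31 ?_
      convert h using 1 <;> omega
    · have := hbox _ _ (Or.inl h); omega
    · have := hbox _ _ (Or.inl h); omega
    · have := hbox _ _ (Or.inr h); omega
  have hRf10 : ¬ Rf (-1) 0 := by
    intro h
    rcases hRf _ _ h with ⟨k, h1, h2, h⟩ | ⟨d, h1, h2, h⟩ | ⟨d, h1, h2, h⟩ | h
    · exact hRfneg _ h
    · have := hbox _ _ (Or.inl h); omega
    · have := hbox _ _ (Or.inl h); omega
    · have := hbox _ _ (Or.inr h); omega
  constructor
  · intro p q h h0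
    have hp := hbox _ _ (Or.inl h)
    simp only [mem_insert_iff, mem_singleton_iff, Prod.mk.injEq]
    obtain ⟨rfl | rfl | rfl, hp⟩ := hp
    · rcases hTr _ _ h with ⟨k, h1, h2, h⟩ | ⟨d, h1, h2, h⟩ | ⟨d, h1, h2, h⟩ | h
      · have := hbox _ _ (Or.inl h); omega
      · have := hbox _ _ (Or.inr h); omega
      · have := hbox _ _ (Or.inr h); omega
      · have := hbox _ _ (Or.inl h); omega
    · omega
    · rcases hTr _ _ h with ⟨k, h1, h2, h⟩ | ⟨d, h1, h2, h⟩ | ⟨d, h1, h2, h⟩ | h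
      · have := hbox _ _ (Or.inl h); omega
      · have := hbox _ _ (Or.inr h); omega
      · have := hbox _ _ (Or.inr h); omega
      · have := hbox _ _ (Or.inl h); omega
  · intro p q h
    have hp := hbox _ _ (Or.inr h)
    simp only [mem_insert_iff, mem_singleton_iff, Prod.mk.injEq]
    obtain ⟨rfl | rfl | rfl, hp⟩ := hp
    · exact (hRfneg _ h).elim
    · have : p ≠ -1 := by rintro rfl; exact hRf10 h
      omega
    · have : p ≠ 3 := by rintro rfl; exact hRf31 h
      omega

theorem CrysEq.exists_image {B : ℤ} {T : Set Pt} (hT : CrysEq 2 B T) {x : Pt} (hx : x ∈ T) :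
    (∃ y ∈ T, ∃ d : ℤ, 0 ≤ d ∧ d ≤ B - 2 ∧
      y 0 = -B * x 1 + (B - 1) / 2 - d ∧ y 1 = x 0 - 2 * x 1) ∨
    (∃ y ∈ T, y 0 = B * x 1 - (B - 1) / 2 ∧ y 1 = 2 * x 1 - x 0) := by
  have h := hT.subset (mem_image_of_mem _ hx)
  rcases h with h | h
  · simp only [mem_iUnion, Finset.mem_Icc] at h
    obtain ⟨d, hd, y, hy, hxy⟩ := h
    have h0 := congrFun hxy 0
    have h1 := congrFun hxy 1
    simp [dotProduct, Fin.sum_univ_two] at h0 h1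
    exact Or.inl ⟨y, hy, d, hd.1, hd.2, by linarith, by linarith⟩
  · refine Or.inr ⟨_, h, ?_, ?_⟩ <;>
      simp [dotProduct, Fin.sum_univ_two] <;> ring

theorem CrysEq.exists_preimage_add {B : ℤ} {T : Set Pt} (hT : CrysEq 2 B T) {y : Pt} (hy : y ∈ T)
    {d : ℤ} (h0 : 0 ≤ d) (hd : d ≤ B - 2) :
    ∃ x ∈ T, y 0 = -B * x 1 + (B - 1) / 2 - d ∧ y 1 = x 0 - 2 * x 1 := by
  have h : y + ![(d : ℝ), 0] ∈
      (⋃ i ∈ Finset.Icc (0:ℤ) (B-2), (fun x => x + ![(i:ℝ), 0]) '' T) ∪ (-T) :=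
    Or.inl (mem_biUnion (x := d) (by simpa using ⟨h0, hd⟩) ⟨y, hy, rfl⟩)
  obtain ⟨x, hx, hxy⟩ := hT.superset h
  have e0 := congrFun hxy 0
  have e1 := congrFun hxy 1
  simp [dotProduct, Fin.sum_univ_two] at e0 e1
  exact ⟨x, hx, by linarith, by linarith⟩

theorem CrysEq.exists_preimage_neg {B : ℤ} {T : Set Pt} (hT : CrysEq 2 B T) {y : Pt} (hy : y ∈ T) :
    ∃ x ∈ T, y 0 = B * x 1 - (B - 1) / 2 ∧ y 1 = 2 * x 1 - x 0 := by
  have h : -y ∈ (⋃ i ∈ Finset.Icc (0:ℤ) (B-2), (fun x => x + ![(i:ℝ), 0]) '' T) ∪ (-T) :=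
    Or.inr (by simpa using hy)
  obtain ⟨x, hx, hxy⟩ := hT.superset h
  have e0 := congrFun hxy 0
  have e1 := congrFun hxy 1
  simp [dotProduct, Fin.sum_univ_two] at e0 e1
  exact ⟨x, hx, by linarith, by linarith⟩

theorem touch_bounded {T : Set Pt} (hTc : IsCompact T) :
    ∃ C : ℤ, ∀ p q, Touch T 1 p q ∨ Touch T (-1) p q → |p| ≤ C ∧ |q| ≤ C := by
  obtain ⟨r, hr⟩ := hTc.isBounded.exists_norm_le
  have hc : ∀ x ∈ T, ∀ i, |x i| ≤ r := fun x hx i => (norm_le_pi_norm x i).trans (hr x hx)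
  refine ⟨⌈2 * r⌉, fun p q h => ?_⟩
  have key : |(p : ℝ)| ≤ 2 * r ∧ |(q : ℝ)| ≤ 2 * r := by
    rcases h with ⟨x, hx, y, hy, e0, e1⟩ | ⟨x, hx, y, hy, e0, e1⟩ <;>
    · have a := abs_le.1 (hc x hx 0)
      have b := abs_le.1 (hc x hx 1)
      have c := abs_le.1 (hc y hy 0)
      have d := abs_le.1 (hc y hy 1)
      exact ⟨abs_le.2 ⟨by linarith, by linarith⟩, abs_le.2 ⟨by linarith, by linarith⟩⟩
  constructor
  · exact_mod_cast key.1.trans (Int.le_ceil _)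
  · exact_mod_cast key.2.trans (Int.le_ceil _)

theorem CrysEq.touch_one_step {B : ℤ} {T : Set Pt} (hT : CrysEq 2 B T) (p q : ℤ)
    (h : Touch T 1 p q) :
    (∃ k, -(B - 2) ≤ k ∧ k ≤ B - 2 ∧ Touch T 1 (-(B * q) + k) (p - 2 * q)) ∨
    (∃ d, 0 ≤ d ∧ d ≤ B - 2 ∧ Touch T (-1) (-(B * q) - d) (p - 2 * q)) ∨
    (∃ d, 0 ≤ d ∧ d ≤ B - 2 ∧ Touch T (-1) (B * q - d) (2 * q - p)) ∨
    Touch T 1 (B * q) (2 * q - p) := by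
  obtain ⟨x, hx, x', hx', e0, e1⟩ := h
  rcases hT.exists_image hx with ⟨y, hy, d, hd0, hd1, f0, f1⟩ | ⟨y, hy, f0, f1⟩ <;>
  rcases hT.exists_image hx' with ⟨y', hy', d', hd0', hd1', f0', f1'⟩ | ⟨y', hy', f0', f1'⟩
  · refine Or.inl ⟨d' - d, by linarith, by linarith, y, hy, y', hy', ?_, ?_⟩ <;>
      simp only [f0, f1, f0', f1', e0, e1] <;> push_cast <;> ring
  · refine Or.inr (Or.inl ⟨d, hd0, hd1, y, hy, y', hy', ?_, ?_⟩) <;>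
      simp only [f0, f1, f0', f1', e0, e1] <;> push_cast <;> ring
  · refine Or.inr (Or.inr (Or.inl ⟨d', hd0', hd1', y, hy, y', hy', ?_, ?_⟩)) <;>
      simp only [f0, f1, f0', f1', e0, e1] <;> push_cast <;> ring
  · refine Or.inr (Or.inr (Or.inr ⟨y, hy, y', hy', ?_, ?_⟩)) <;>
      simp only [f0, f1, f0', f1', e0, e1] <;> push_cast <;> ring

theorem CrysEq.touch_neg_one_step {B : ℤ} {T : Set Pt} (hT : CrysEq 2 B T) (p q : ℤ)
    (h : Touch T (-1) p q) :
    (∃ m, 0 ≤ m ∧ m ≤ 2 * B - 4 ∧ Touch T (-1) (-(B * q) + (B - 1) - m) (p - 2 * q)) ∨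
    (∃ d, 0 ≤ d ∧ d ≤ B - 2 ∧ Touch T 1 (-(B * q) + (B - 1) - d) (p - 2 * q)) ∨
    (∃ d, 0 ≤ d ∧ d ≤ B - 2 ∧ Touch T 1 (B * q - (B - 1) + d) (2 * q - p)) ∨
    Touch T (-1) (B * q - (B - 1)) (2 * q - p) := by
  obtain ⟨x, hx, x', hx', e0, e1⟩ := h
  rcases hT.exists_image hx with ⟨y, hy, d, hd0, hd1, f0, f1⟩ | ⟨y, hy, f0, f1⟩ <;>
  rcases hT.exists_image hx' with ⟨y', hy', d', hd0', hd1', f0', f1'⟩ | ⟨y', hy', f0', f1'⟩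
  · refine Or.inl ⟨d + d', by linarith, by linarith, y, hy, y', hy', ?_, ?_⟩ <;>
      simp only [f0, f1, f0', f1', e0, e1] <;> push_cast <;> ring
  · refine Or.inr (Or.inl ⟨d, hd0, hd1, y, hy, y', hy', ?_, ?_⟩) <;>
      simp only [f0, f1, f0', f1', e0, e1] <;> push_cast <;> ring
  · refine Or.inr (Or.inr (Or.inl ⟨d', hd0', hd1', y, hy, y', hy', ?_, ?_⟩)) <;>
      simp only [f0, f1, f0', f1', e0, e1] <;> push_cast <;> ring
  · refine Or.inr (Or.inr (Or.inr ⟨y, hy, y', hy', ?_, ?_⟩)) <;>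
      simp only [f0, f1, f0', f1', e0, e1] <;> push_cast <;> ring

theorem crysForm_scale {B a b a' b' s : ℝ} (hB : B ≠ 0) (hs : s ^ 2 = 1)
    (ha : a' = s * (-B * b)) (hb : b' = s * (a - 2 * b)) :
    crysForm B a' b' / B = crysForm B a b := by
  rw [div_eq_iff hB, ha, hb]
  unfold crysForm
  linear_combination ((-B * b - (a - 2 * b)) ^ 2 + (B - 1) * (a - 2 * b) ^ 2) * hs

theorem eq_zero_of_crysForm_nonpos {B a b : ℝ} (hB : 1 < B) (h : crysForm B a b ≤ 0) :
    a = 0 ∧ b = 0 := by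
  unfold crysForm at h
  have hb : b = 0 := by
    by_contra hb
    have : 0 < b ^ 2 := by positivity
    nlinarith [sq_nonneg (a - b)]
  subst hb
  exact ⟨by nlinarith [sq_nonneg a], rfl⟩

theorem touch_of_zero_mem_gapValues {B : ℝ} (hB : 1 < B) {T : Set Pt} {ε : ℝ} {p q : ℤ}
    (h : 0 ∈ gapValues B T ε p q) : Touch T ε p q := by
  obtain ⟨x, hx, y, hy, e⟩ := h
  obtain ⟨h0, h1⟩ := eq_zero_of_crysForm_nonpos hB e.ge
  exact ⟨x, hx, y, hy, by linarith, by linarith⟩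

theorem zero_mem_gapValues_of_contract {B : ℝ} (hB : 1 < B) {T : Set Pt} (hTne : T.Nonempty)
    (hTc : IsCompact T) {ε p q c : ℝ} (hc : 1 < c)
    (h : ∀ t ∈ gapValues B T ε p q, t / c ∈ gapValues B T ε p q) : 0 ∈ gapValues B T ε p q := by
  obtain ⟨⟨x, y⟩, ⟨hx, hy⟩, hmin⟩ := (hTc.prod hTc).exists_isMinOn (hTne.prod hTne)
    (f := fun z : Pt × Pt => crysForm B (z.1 0 - ε * z.2 0 - p) (z.1 1 - ε * z.2 1 - q))
    (by unfold crysForm; fun_prop)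
  obtain ⟨x', hx', y', hy', e⟩ := h _ ⟨x, hx, y, hy, rfl⟩
  have hle := isMinOn_iff.1 hmin (x', y') ⟨hx', hy'⟩
  simp only [← e] at hle
  rw [le_div_iff₀ (by linarith)] at hle
  have hn : crysForm B (x 0 - ε * y 0 - p) (x 1 - ε * y 1 - q) ≤ 0 := by nlinarith
  obtain ⟨h0, h1⟩ := eq_zero_of_crysForm_nonpos hB hn
  exact ⟨x, hx, y, hy, by rw [h0, h1]; simp [crysForm]⟩

theorem gapValues_one_neg {B : ℝ} {T : Set Pt} {p q t : ℝ} (h : t ∈ gapValues B T 1 p q) :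
    t ∈ gapValues B T 1 (-p) (-q) := by
  obtain ⟨x, hx, y, hy, rfl⟩ := h
  exact ⟨y, hy, x, hx, by unfold crysForm; ring⟩

theorem touch_one_iff {T : Set Pt} {p q : ℤ} :
    (T ∩ (fun x : Pt => x + ![(p:ℝ), (q:ℝ)]) '' T).Nonempty ↔ Touch T 1 p q := by
  constructor
  · rintro ⟨_, hx, y, hy, rfl⟩
    exact ⟨_, hx, y, hy, by simp, by simp⟩
  · rintro ⟨x, hx, y, hy, h0, h1⟩
    refine ⟨x, hx, y, hy, ?_⟩
    ext i
    fin_cases i <;> simp [h0, h1]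

theorem touch_neg_one_iff {T : Set Pt} {p q : ℤ} :
    (T ∩ (fun x : Pt => -x + ![(p:ℝ), (q:ℝ)]) '' T).Nonempty ↔ Touch T (-1) p q := by
  constructor
  · rintro ⟨_, hx, y, hy, rfl⟩
    exact ⟨_, hx, y, hy, by simp, by simp⟩
  · rintro ⟨x, hx, y, hy, h0, h1⟩
    refine ⟨x, hx, y, hy, ?_⟩
    ext i
    fin_cases i <;> simp [h0, h1]

section GapSteps

variable {B : ℤ} {T : Set Pt} {t : ℝ}

theorem CrysEq.gapValues_add_add (hT : CrysEq 2 B T) (hB : 3 ≤ B) {ε p q p' q' : ℝ} {d d' : ℤ}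
    (hd0 : 0 ≤ d) (hd1 : d ≤ B - 2) (hd0' : 0 ≤ d') (hd1' : d' ≤ B - 2)
    (hp : p' = -B * q + (1 - ε) * ((B - 1) / 2) - d + ε * d') (hq : q' = p - 2 * q)
    (h : t ∈ gapValues B T ε p' q') : t / B ∈ gapValues B T ε p q := by
  obtain ⟨y, hy, y', hy', rfl⟩ := h
  obtain ⟨x, hx, e0, e1⟩ := hT.exists_preimage_add hy hd0 hd1
  obtain ⟨x', hx', e0', e1'⟩ := hT.exists_preimage_add hy' hd0' hd1'
  have hB' : (3 : ℝ) ≤ B := mod_cast hB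
  refine ⟨x, hx, x', hx', crysForm_scale (s := 1) (by linarith) (by norm_num) ?_ ?_⟩
  · rw [e0, e0', hp]; ring
  · rw [e1, e1', hq]; ring

theorem CrysEq.gapValues_add_neg (hT : CrysEq 2 B T) (hB : 3 ≤ B) {ε p q p' q' : ℝ} {d : ℤ}
    (hd0 : 0 ≤ d) (hd1 : d ≤ B - 2)
    (hp : p' = -B * q + (1 - ε) * ((B - 1) / 2) - d) (hq : q' = p - 2 * q)
    (h : t ∈ gapValues B T (-ε) p' q') : t / B ∈ gapValues B T ε p q := by
  obtain ⟨y, hy, y', hy', rfl⟩ := h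
  obtain ⟨x, hx, e0, e1⟩ := hT.exists_preimage_add hy hd0 hd1
  obtain ⟨x', hx', e0', e1'⟩ := hT.exists_preimage_neg hy'
  have hB' : (3 : ℝ) ≤ B := mod_cast hB
  refine ⟨x, hx, x', hx', crysForm_scale (s := 1) (by linarith) (by norm_num) ?_ ?_⟩
  · rw [e0, e0', hp]; ring
  · rw [e1, e1', hq]; ring

theorem CrysEq.gapValues_neg_add (hT : CrysEq 2 B T) (hB : 3 ≤ B) {ε p q p' q' : ℝ} {d : ℤ}
    (hd0 : 0 ≤ d) (hd1 : d ≤ B - 2)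
    (hp : p' = B * q - (1 - ε) * ((B - 1) / 2) - ε * d) (hq : q' = 2 * q - p)
    (h : t ∈ gapValues B T (-ε) p' q') : t / B ∈ gapValues B T ε p q := by
  obtain ⟨y, hy, y', hy', rfl⟩ := h
  obtain ⟨x, hx, e0, e1⟩ := hT.exists_preimage_neg hy
  obtain ⟨x', hx', e0', e1'⟩ := hT.exists_preimage_add hy' hd0 hd1
  have hB' : (3 : ℝ) ≤ B := mod_cast hB
  refine ⟨x, hx, x', hx', crysForm_scale (s := -1) (by linarith) (by norm_num) ?_ ?_⟩
  · rw [e0, e0', hp]; ring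
  · rw [e1, e1', hq]; ring

end GapSteps

theorem stmt_10 (B : ℤ) (hB : 3 ≤ B)
    (T : Set Pt) (hTne : T.Nonempty) (hTc : IsCompact T) (hT : CrysEq 2 B T) :
    (∀ p q : ℤ, ¬(p = 0 ∧ q = 0) →
      ((T ∩ (fun x : Pt => x + ![(p:ℝ), (q:ℝ)]) '' T).Nonempty ↔
        (p, q) ∈ ({(1,0), (-1,0), (1,1), (-1,-1)} : Set (ℤ × ℤ)))) ∧
    (∀ p q : ℤ,
      ((T ∩ (fun x : Pt => -x + ![(p:ℝ), (q:ℝ)]) '' T).Nonempty ↔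
        (p, q) ∈ ({(0,0), (1,0), (1,1), (2,1)} : Set (ℤ × ℤ)))) := by
  have hB' : (3 : ℝ) ≤ B := mod_cast hB
  have hB1 : (1 : ℝ) < B := by linarith
  have hcube : (1 : ℝ) < B * B * B := by nlinarith
  obtain ⟨clsT, clsR⟩ := bounded_walk_classification hB (touch_bounded hTc)
    hT.touch_one_step hT.touch_neg_one_step
  have s10 : ∀ t ∈ gapValues B T 1 1 1, t / B ∈ gapValues B T 1 1 0 := fun t h =>
    hT.gapValues_add_add hB (d := 0) (d' := 1) le_rfl (by linarith) zero_le_one (by linarith)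
      (by push_cast; ring) (by ring) h
  have s11 : ∀ t ∈ gapValues B T (-1) 2 1, t / B ∈ gapValues B T 1 1 1 := fun t h =>
    hT.gapValues_neg_add hB (d := B - 2) (by linarith) le_rfl
      (by push_cast; ring) (by ring) h
  have s21 : ∀ t ∈ gapValues B T 1 1 0, t / B ∈ gapValues B T (-1) 2 1 := fun t h =>
    hT.gapValues_add_neg hB (d := 0) le_rfl (by linarith) (p' := -1) (q' := 0)
      (by push_cast; ring) (by ring) (by simpa using gapValues_one_neg h)
  have r11 : ∀ t ∈ gapValues B T 1 1 1, t / B ∈ gapValues B T (-1) 1 1 := fun t h =>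
    hT.gapValues_add_neg hB (d := 0) le_rfl (by linarith) (p' := -1) (q' := -1)
      (by push_cast; ring) (by ring) (by simpa using gapValues_one_neg h)
  have r10 : ∀ t ∈ gapValues B T (-1) 1 1, t / B ∈ gapValues B T (-1) 1 0 := fun t h =>
    hT.gapValues_add_add hB (d := 0) (d' := B - 2) le_rfl (by linarith) (by linarith) le_rfl
      (by push_cast; ring) (by ring) h
  have r00 : ∀ t ∈ gapValues B T (-1) 0 0, t / B ∈ gapValues B T (-1) 0 0 := fun t h =>
    hT.gapValues_add_add hB (d := 1) (d' := B - 2) zero_le_one (by linarith) (by linarith) le_rfl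
      (by push_cast; ring) (by ring) h
  have z10 : 0 ∈ gapValues B T 1 1 0 :=
    zero_mem_gapValues_of_contract hB1 hTne hTc hcube fun t h => by
      simpa only [div_div] using s10 _ (s11 _ (s21 _ h))
  have z21 : 0 ∈ gapValues B T (-1) 2 1 := by simpa using s21 _ z10
  have z11 : 0 ∈ gapValues B T 1 1 1 := by simpa using s11 _ z21
  have w11 : 0 ∈ gapValues B T (-1) 1 1 := by simpa using r11 _ z11
  have w10 : 0 ∈ gapValues B T (-1) 1 0 := by simpa using r10 _ w11
  have w00 : 0 ∈ gapValues B T (-1) 0 0 := zero_mem_gapValues_of_contract hB1 hTne hTc hB1 r00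
  refine ⟨fun p q h0 => ?_, fun p q => ?_⟩
  · rw [touch_one_iff]
    refine ⟨fun h => clsT p q h h0, fun h => touch_of_zero_mem_gapValues hB1 ?_⟩
    simp only [mem_insert_iff, mem_singleton_iff, Prod.mk.injEq] at h
    obtain ⟨rfl, rfl⟩ | ⟨rfl, rfl⟩ | ⟨rfl, rfl⟩ | ⟨rfl, rfl⟩ := h
    · simpa using z10
    · simpa using gapValues_one_neg z10
    · simpa using z11
    · simpa using gapValues_one_neg z11
  · rw [touch_neg_one_iff]
    refine ⟨clsR p q, fun h => touch_of_zero_mem_gapValues hB1 ?_⟩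
    simp only [mem_insert_iff, mem_singleton_iff, Prod.mk.injEq] at h
    obtain ⟨rfl, rfl⟩ | ⟨rfl, rfl⟩ | ⟨rfl, rfl⟩ | ⟨rfl, rfl⟩ := h
    · simpa using w00
    · simpa using w10
    · simpa using w11
    · simpa using z21
end
end
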